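/- arXiv:math-ph/0103025 — 11 statements merged into one kernel-verified Lean document; each statement's English description precedes it below -/
import Mathlib

section
/- Let α₀, α₁, α₂ be real numbers with α₀ + α₁ + α₂ = 1, and let f₀, f₁, f₂ : ℝ → ℝ be differentiable functions satisfying the symmetric PIV system f₀'(t) = f₀(t)(f₁(t) − f₂(t)) + 2α₀, f₁'(t) = f₁(t)(f₂(t) − f₀(t)) + 2α₁, f₂'(t) = f₂(t)(f₀(t) − f₁(t)) + 2α₂, together with the constraint f₀(t) + f₁(t) + f₂(t) = 2t for all t. If the function y := −f₁ is nowhere vanishing, then y satisfies the fourth Painlevé equation y'' = (y')²/(2y) + (3/2)y³ + 4t y² + 2(t² − α)y + β/y with parameters α = α₀ − α₂ and β = −2α₁². -/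
/-- The symmetric PIV system implies that `y = -f₁` satisfies the fourth Painlevé
equation with parameters `α = α₀ - α₂`, `β = -2α₁²`. -/
theorem symmetric_PIV_implies_PIV
    (α₀ α₁ α₂ : ℝ) (hsum : α₀ + α₁ + α₂ = 1)
    (f₀ f₁ f₂ : ℝ → ℝ)
    (hf₀ : Differentiable ℝ f₀) (hf₁ : Differentiable ℝ f₁) (hf₂ : Differentiable ℝ f₂)
    (h₀ : ∀ t, deriv f₀ t = f₀ t * (f₁ t - f₂ t) + 2 * α₀)
    (h₁ : ∀ t, deriv f₁ t = f₁ t * (f₂ t - f₀ t) + 2 * α₁)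
    (h₂ : ∀ t, deriv f₂ t = f₂ t * (f₀ t - f₁ t) + 2 * α₂)
    (hcon : ∀ t, f₀ t + f₁ t + f₂ t = 2 * t)
    (y : ℝ → ℝ) (hy : y = fun t => - f₁ t)
    (hnv : ∀ t, y t ≠ 0) :
    ∀ t, deriv (deriv y) t =
      (deriv y t) ^ 2 / (2 * y t) + (3 / 2) * (y t) ^ 3 + 4 * t * (y t) ^ 2
        + 2 * (t ^ 2 - (α₀ - α₂)) * y t + (-2 * α₁ ^ 2) / y t := by
  intro t
  have hg : f₁ t ≠ 0 := by simpa [hy] using hnv t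
  have hdy : deriv y = fun s => -(f₁ s * (f₂ s - f₀ s) + 2 * α₁) := by
    funext s
    rw [hy, deriv.fun_neg, h₁]
  have hddy : deriv (deriv y) t =
      -(deriv f₁ t * (f₂ t - f₀ t) + f₁ t * (deriv f₂ t - deriv f₀ t)) := by
    rw [hdy]
    exact (((hf₁ t).hasDerivAt.mul
      ((hf₂ t).hasDerivAt.sub (hf₀ t).hasDerivAt)).add_const (2 * α₁)).neg.deriv
  have ht : t = (f₀ t + f₁ t + f₂ t) / 2 := by linarith [hcon t]
  rw [hddy, hdy, h₀, h₁, h₂, hy]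
  dsimp only
  generalize f₀ t = a at *
  generalize f₁ t = b at *
  generalize f₂ t = c at *
  subst ht
  field_simp
  ring
end

section
/- Let α : ZMod 3 → ℝ and let f₀, f₁, f₂ : ℝ → ℝ be differentiable functions satisfying the symmetric PIV system f_j' = f_j(f_{j+1} − f_{j+2}) + 2α_j for all j ∈ ZMod 3 (indices mod 3). Then: (i) (Reflections s_i) For each fixed i ∈ ZMod 3 such that f_i is nowhere vanishing, the functions g_j := f_j + 2α_i u_{ij}/f_i, where u_{ii} = 0, u_{i,i+1} = 1, u_{i,i+2} = −1, satisfy the symmetric PIV system with parameters β_j := α_j − α_i a_{ij}, where a_{ii} = 2 and a_{ij} = −1 for j ≠ i. (ii) (Rotation π) The functions h_j := f_{j+1} satisfy the symmetric PIV system with parameters γ_j := α_{j+1}. -/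
theorem ZMod.three_add_add (i : ZMod 3) :
    i + 1 + 1 = i + 2 ∧ i + 1 + 2 = i ∧ i + 2 + 1 = i ∧ i + 2 + 2 = i + 1 := by
  decide +revert

theorem ZMod.three_add_ne (i : ZMod 3) : i + 1 ≠ i ∧ i + 2 ≠ i ∧ i + 2 ≠ i + 1 := by
  decide +revert

theorem ZMod.three_eq_or_eq_add (i j : ZMod 3) : j = i ∨ j = i + 1 ∨ j = i + 2 := by
  decide +revert

/-- Bäcklund transformations of the symmetric PIV system: the reflections `sᵢ`
(with `u` the orientation matrix and `a` the Cartan matrix of `A₂⁽¹⁾`) and the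
rotation `π` map solutions to solutions. -/
theorem PIV_Backlund_transformations
    (α : ZMod 3 → ℝ) (f : ZMod 3 → ℝ → ℝ)
    (hdiff : ∀ j, Differentiable ℝ (f j))
    (hsys : ∀ j t, deriv (f j) t = f j t * (f (j + 1) t - f (j + 2) t) + 2 * α j) :
    -- (i) reflections s_i
    (∀ i : ZMod 3, (∀ t, f i t ≠ 0) →
      ∀ j t,
        deriv (fun s => f j s
            + 2 * α i * (if j = i then 0 else if j = i + 1 then 1 else -1) / f i s) t
          = (f j t + 2 * α i * (if j = i then 0 else if j = i + 1 then 1 else -1) / f i t)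
              * ((f (j + 1) t
                    + 2 * α i * (if j + 1 = i then 0 else if j + 1 = i + 1 then 1 else -1)
                        / f i t)
                - (f (j + 2) t
                    + 2 * α i * (if j + 2 = i then 0 else if j + 2 = i + 1 then 1 else -1)
                        / f i t))
            + 2 * (α j - α i * (if j = i then 2 else -1)))
    ∧
    -- (ii) rotation π
    (∀ j t, deriv (fun s => f (j + 1) s) t
        = f (j + 1) t * (f (j + 1 + 1) t - f (j + 1 + 2) t) + 2 * α (j + 1)) := by
  refine ⟨fun i hi j t => ?_, fun j t => hsys (j + 1) t⟩
  have hderiv (c : ℝ) : deriv (fun s => f j s + c / f i s) t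
      = f j t * (f (j + 1) t - f (j + 2) t) + 2 * α j
        - c * (f i t * (f (i + 1) t - f (i + 2) t) + 2 * α i) / f i t ^ 2 := by
    have hj := (hdiff j t).hasDerivAt
    have hquot := (hasDerivAt_const t c).fun_div (hdiff i t).hasDerivAt (hi t)
    rw [(hj.fun_add hquot).deriv, hsys, hsys]
    ring
  rw [hderiv]
  have hit := hi t
  obtain ⟨h11, h12, h21, h22⟩ := ZMod.three_add_add i
  obtain ⟨h1, h2, h3⟩ := ZMod.three_add_ne i
  rcases ZMod.three_eq_or_eq_add i j with rfl | rfl | rfl <;>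
  · simp only [h11, h12, h21, h22, h1, h2, h3, h1.symm, if_true, if_false]
    field_simp
    ring
end

section
/- Let α₁, α₂ be real numbers and let q, p : ℝ → ℝ be differentiable functions satisfying Hamilton's equations for the PIV Hamiltonian H(t,q,p) = (2p − q − 2t)pq − 2α₁p − α₂q, namely q'(t) = q(t)(4p(t) − q(t) − 2t) − 2α₁ and p'(t) = p(t)(2q(t) − 2p(t) + 2t) + α₂. Define f₀(t) := 2t + q(t) − 2p(t), f₁(t) := −q(t), f₂(t) := 2p(t), and α₀ := 1 − α₁ − α₂. Then f₀ + f₁ + f₂ = 2t identically and (f₀, f₁, f₂) satisfies the symmetric PIV system f₀' = f₀(f₁ − f₂) + 2α₀, f₁' = f₁(f₂ − f₀) + 2α₁, f₂' = f₂(f₀ − f₁) + 2α₂. -/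
/-- Hamilton's equations for the PIV Hamiltonian `H = (2p - q - 2t)pq - 2α₁p - α₂q`
are equivalent to the symmetric PIV system with `f₀ = 2t + q - 2p`, `f₁ = -q`,
`f₂ = 2p`, `α₀ = 1 - α₁ - α₂`. -/
theorem PIV_Hamilton_equations_give_symmetric_system
    (α₁ α₂ : ℝ) (q p : ℝ → ℝ)
    (hq : Differentiable ℝ q) (hp : Differentiable ℝ p)
    (heq : ∀ t, deriv q t = q t * (4 * p t - q t - 2 * t) - 2 * α₁)
    (hep : ∀ t, deriv p t = p t * (2 * q t - 2 * p t + 2 * t) + α₂) :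
    (∀ t, (2 * t + q t - 2 * p t) + (- q t) + (2 * p t) = 2 * t)
    ∧ (∀ t, deriv (fun s => 2 * s + q s - 2 * p s) t
        = (2 * t + q t - 2 * p t) * ((- q t) - 2 * p t) + 2 * (1 - α₁ - α₂))
    ∧ (∀ t, deriv (fun s => - q s) t
        = (- q t) * (2 * p t - (2 * t + q t - 2 * p t)) + 2 * α₁)
    ∧ (∀ t, deriv (fun s => 2 * p s) t
        = (2 * p t) * ((2 * t + q t - 2 * p t) - (- q t)) + 2 * α₂) := by
  have hdq (t : ℝ) := (hq t).hasDerivAt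
  have hdp (t : ℝ) := (hp t).hasDerivAt.const_mul 2
  refine ⟨fun t => by ring, fun t => ?_, fun t => ?_, fun t => ?_⟩
  · have h := ((((hasDerivAt_id' t).const_mul 2).fun_add (hdq t)).fun_sub (hdp t)).deriv
    rw [h, heq, hep]
    ring
  · rw [(hdq t).fun_neg.deriv, heq]
    ring
  · rw [(hdp t).deriv, hep]
    ring
end

section
/- Let α₁, α₂ be real numbers and let q, p : ℝ → ℝ be differentiable functions satisfying q'(t) = q(t)(4p(t) − q(t) − 2t) − 2α₁ and p'(t) = p(t)(2q(t) − 2p(t) + 2t) + α₂. Define the Hamiltonian function h(t) := (2p(t) − q(t) − 2t)p(t)q(t) − 2α₁p(t) − α₂q(t). Then h is twice differentiable and satisfies the Jimbo–Miwa–Okamoto σ-form of the PIV equation: (h''(t))² − 4(t·h'(t) − h(t))² + 4h'(t)(h'(t) + 2α₁)(h'(t) − 2α₂) = 0 for all t. -/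
/-- The PIV Hamiltonian `h(t) = (2p - q - 2t)pq - 2α₁p - α₂q`, evaluated along a
solution of Hamilton's equations, satisfies the Jimbo–Miwa–Okamoto σ-form of PIV:
`(h'')² - 4(th' - h)² + 4h'(h' + 2α₁)(h' - 2α₂) = 0`. -/
theorem PIV_Hamiltonian_satisfies_sigma_form
    (α₁ α₂ : ℝ) (q p : ℝ → ℝ)
    (hq : Differentiable ℝ q) (hp : Differentiable ℝ p)
    (heq : ∀ t, deriv q t = q t * (4 * p t - q t - 2 * t) - 2 * α₁)
    (hep : ∀ t, deriv p t = p t * (2 * q t - 2 * p t + 2 * t) + α₂)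
    (h : ℝ → ℝ)
    (hh : h = fun t => (2 * p t - q t - 2 * t) * p t * q t - 2 * α₁ * p t - α₂ * q t) :
    Differentiable ℝ h ∧ Differentiable ℝ (deriv h) ∧
    ∀ t, (deriv (deriv h) t) ^ 2 - 4 * (t * deriv h t - h t) ^ 2
        + 4 * deriv h t * (deriv h t + 2 * α₁) * (deriv h t - 2 * α₂) = 0 := by
  have hq' t := (hq t).hasDerivAt
  have hp' t := (hp t).hasDerivAt
  have hh' : ∀ t, HasDerivAt h (-2 * (p t * q t)) t := by
    intro t
    rw [hh]
    have key := ((((((hp' t).const_mul 2).sub (hq' t)).sub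
      ((hasDerivAt_id' t).const_mul 2)).mul (hp' t)).mul (hq' t)).sub
      ((hp' t).const_mul (2 * α₁)) |>.sub ((hq' t).const_mul α₂)
    refine key.congr_deriv ?_
    simp only [Pi.sub_apply, Pi.mul_apply, heq, hep]
    ring
  have hderiv : deriv h = fun t => -2 * (p t * q t) := funext fun t => (hh' t).deriv
  have hh'' : ∀ t, HasDerivAt (deriv h) (-2 * (deriv p t * q t + p t * deriv q t)) t := by
    intro t
    rw [hderiv]
    exact ((hp' t).mul (hq' t)).const_mul (-2)
  refine ⟨fun t => (hh' t).differentiableAt, fun t => (hh'' t).differentiableAt, fun t => ?_⟩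
  rw [(hh'' t).deriv, (hh' t).deriv, heq, hep, hh]
  ring
end

section
/- Let f : ℝ → ℝ be a smooth (infinitely differentiable) function. For n ≥ 1 define the Hankel (double Wronskian) determinant σ_n(t) := det[f^{(i+j)}(t)]_{i,j=0,…,n−1}, and set σ₀(t) := 1. Then for every n ≥ 1 and every t ∈ ℝ, the Toda lattice equation holds in the form σ_n(t)·σ_n''(t) − (σ_n'(t))² = σ_{n+1}(t)·σ_{n−1}(t); equivalently, wherever σ_n is nonvanishing, (d²/dt²) log σ_n = σ_{n+1}σ_{n−1}/σ_n². -/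
open Matrix in
/-- **Jacobi's complementary minor identity**, before cancelling `M.det`. -/
theorem det_mul_det_adjugate_toBlocks₂₂ {R m n : Type*} [CommRing R] [Fintype m] [DecidableEq m]
    [Fintype n] [DecidableEq n] (M : Matrix (m ⊕ n) (m ⊕ n) R) :
    M.det * M.adjugate.toBlocks₂₂.det = M.toBlocks₁₁.det * M.det ^ Fintype.card n := by
  have hblocks := M.mul_adjugate
  rw [← fromBlocks_toBlocks M.adjugate] at hblocks
  nth_rw 1 [← fromBlocks_toBlocks M] at hblocks
  rw [fromBlocks_multiply, ← fromBlocks_one, fromBlocks_smul, fromBlocks_inj] at hblocks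
  obtain ⟨-, h₁₂, -, h₂₂⟩ := hblocks
  have hmul : M * fromBlocks 1 M.adjugate.toBlocks₁₂ 0 M.adjugate.toBlocks₂₂ =
      fromBlocks M.toBlocks₁₁ 0 M.toBlocks₂₁ (M.det • 1) := by
    nth_rw 1 [← fromBlocks_toBlocks M]
    rw [fromBlocks_multiply, h₁₂, h₂₂]
    simp
  simpa [det_fromBlocks_zero₂₁, det_fromBlocks_zero₁₂] using congrArg det hmul

open Matrix in
/-- **Jacobi's complementary minor identity** for a complementary minor of size two. -/
theorem det_adjugate_toBlocks₂₂_fin_two {R m : Type*} [CommRing R] [Fintype m] [DecidableEq m]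
    (M : Matrix (m ⊕ Fin 2) (m ⊕ Fin 2) R) :
    M.adjugate.toBlocks₂₂.det = M.toBlocks₁₁.det * M.det := by
  set G := mvPolynomialX (m ⊕ Fin 2) (m ⊕ Fin 2) ℤ
  have hgeneric : G.adjugate.toBlocks₂₂.det = G.toBlocks₁₁.det * G.det := by
    apply mul_left_cancel₀ (det_mvPolynomialX_ne_zero (m ⊕ Fin 2) ℤ)
    rw [det_mul_det_adjugate_toBlocks₂₂, Fintype.card_fin]
    ring
  let φ : MvPolynomial ((m ⊕ Fin 2) × (m ⊕ Fin 2)) ℤ →+* R :=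
    MvPolynomial.eval₂Hom (Int.castRingHom R) fun p => M p.1 p.2
  have hφ : φ.mapMatrix G = M := by
    ext i j
    simp [φ, G]
  have h := congrArg φ hgeneric
  rw [map_mul, φ.map_det, φ.map_det, φ.map_det, hφ] at h
  have h₁₁ : φ.mapMatrix G.toBlocks₁₁ = M.toBlocks₁₁ := by
    rw [← hφ]; rfl
  have h₂₂ : φ.mapMatrix G.adjugate.toBlocks₂₂ = M.adjugate.toBlocks₂₂ := by
    rw [← hφ, ← φ.map_adjugate]; rfl
  rwa [h₁₁, h₂₂] at h

open Matrix in
/-- The **Desnanot–Jacobi identity** for the last two rows and columns. -/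
theorem desnanot_jacobi {R : Type*} [CommRing R] {m : ℕ}
    (M : Matrix (Fin (m + 2)) (Fin (m + 2)) R) :
    (M.submatrix Fin.castSucc Fin.castSucc).det *
        (M.submatrix (Fin.last m).castSucc.succAbove (Fin.last m).castSucc.succAbove).det -
      (M.submatrix Fin.castSucc (Fin.last m).castSucc.succAbove).det *
        (M.submatrix (Fin.last m).castSucc.succAbove Fin.castSucc).det =
      M.det * (M.submatrix (Fin.castAdd 2) (Fin.castAdd 2)).det := by
  let e : Fin m ⊕ Fin 2 ≃ Fin (m + 2) := finSumFinEquiv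
  have h := det_adjugate_toBlocks₂₂_fin_two (M.submatrix e e)
  have h0 : e (Sum.inr 0) = (Fin.last m).castSucc := by ext; simp [e]
  have h1 : e (Sum.inr 1) = Fin.last (m + 1) := by ext; simp [e]
  have h₁₁ : (M.submatrix e e).toBlocks₁₁ = M.submatrix (Fin.castAdd 2) (Fin.castAdd 2) := by
    ext i j
    simp [e, toBlocks₁₁]
  rw [adjugate_submatrix_equiv_self, det_submatrix_equiv_self, h₁₁, det_fin_two] at h
  simp only [toBlocks₂₂, of_apply, submatrix_apply, h0, h1,
    adjugate_fin_succ_eq_det_submatrix, Fin.succAbove_last, Fin.val_last, Fin.val_castSucc] at h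
  simp only [pow_add, pow_one] at h
  rcases neg_one_pow_eq_or R m with hsign | hsign <;> rw [hsign] at h <;> linear_combination h

/-- The derivative of a determinant is the sum over the rows of the determinants in which that
row is differentiated. -/
theorem hasDerivAt_det {𝕜 n : Type*} [NontriviallyNormedField 𝕜] [Fintype n] [DecidableEq n]
    {A : 𝕜 → Matrix n n 𝕜} {A' : Matrix n n 𝕜} {t : 𝕜}
    (hA : ∀ i j, HasDerivAt (fun s => A s i j) (A' i j) t) :
    HasDerivAt (fun s => (A s).det) (∑ k, ((A t).updateRow k (A' k)).det) t := by
  have h : HasDerivAt (fun s => ∑ p : Equiv.Perm n, (Equiv.Perm.sign p : 𝕜) * ∏ i, A s i (p i))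
      (∑ p : Equiv.Perm n, (Equiv.Perm.sign p : 𝕜) *
        ∑ k, (∏ i ∈ Finset.univ.erase k, A t i (p i)) • A' k (p k)) t :=
    HasDerivAt.fun_sum fun p _ =>
      (HasDerivAt.fun_finsetProd fun i _ => hA i (p i)).const_mul _
  convert h using 1
  · ext s
    rw [← Matrix.det_transpose, Matrix.det_apply']
    rfl
  · simp_rw [Finset.mul_sum]
    rw [Finset.sum_comm]
    refine Finset.sum_congr rfl fun k _ => ?_
    rw [← Matrix.det_transpose, Matrix.det_apply']
    refine Finset.sum_congr rfl fun p _ => ?_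
    rw [← Finset.prod_erase_mul _ _ (Finset.mem_univ k), smul_eq_mul]
    congr 2
    · refine Finset.prod_congr rfl fun i hi => ?_
      simp [Matrix.updateRow_ne (Finset.ne_of_mem_erase hi)]
    · simp

/-- The minor of the infinite Hankel matrix of derivatives of `f` with rows `r` and columns `c`. -/
noncomputable def hankelMinor (f : ℝ → ℝ) {n : ℕ} (r c : Fin n → ℕ) (t : ℝ) : ℝ :=
  (Matrix.of fun i j => iteratedDeriv (r i + c j) f t).det

theorem hankelMinor_comm (f : ℝ → ℝ) {n : ℕ} (r c : Fin n → ℕ) :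
    hankelMinor f r c = hankelMinor f c r := by
  ext t
  rw [hankelMinor, ← Matrix.det_transpose, hankelMinor]
  congr 1
  ext i j
  simp [add_comm]

/-- Differentiating a Hankel minor on initial rows shifts the last row by one. -/
theorem hasDerivAt_hankelMinor_val {f : ℝ → ℝ} (hf : ContDiff ℝ (⊤ : ℕ∞) f) {m : ℕ}
    (c : Fin (m + 1) → ℕ) (t : ℝ) :
    HasDerivAt (hankelMinor f Fin.val c)
      (hankelMinor f (fun i => ((Fin.last m).castSucc.succAbove i : ℕ)) c t) t := by
  have hentry (k : ℕ) : HasDerivAt (iteratedDeriv k f) (iteratedDeriv (k + 1) f t) t := by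
    rw [iteratedDeriv_succ]
    exact (hf.differentiable_iteratedDeriv k (by exact_mod_cast ENat.natCast_lt_top k) t).hasDerivAt
  have h := hasDerivAt_det
    (A := fun s => Matrix.of fun i j : Fin (m + 1) => iteratedDeriv ((i : ℕ) + c j) f s)
    (A' := Matrix.of fun i j : Fin (m + 1) => iteratedDeriv ((i : ℕ) + c j + 1) f t)
    (t := t) fun i j => hentry _
  refine h.congr_deriv ?_
  rw [Finset.sum_eq_single_of_mem (Fin.last m) (Finset.mem_univ _)]
  · rw [hankelMinor]
    congr 1
    ext i j
    induction i using Fin.lastCases with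
    | last => simp [add_right_comm]
    | cast i =>
      rw [Matrix.updateRow_ne (Fin.castSucc_lt_last i).ne]
      simp [Fin.succAbove_of_castSucc_lt, Fin.castSucc_lt_last]
  · intro k _ hk
    obtain ⟨i, rfl⟩ := Fin.exists_castSucc_eq.mpr hk
    refine Matrix.det_zero_of_row_eq (Fin.castSucc_lt_succ (i := i)).ne ?_
    rw [Matrix.updateRow_self, Matrix.updateRow_ne (Fin.castSucc_lt_succ (i := i)).ne']
    ext j
    simp [add_right_comm]

/-- The second derivative of `log g` in terms of `g` and its derivatives. -/
theorem deriv_deriv_log_comp {g g' : ℝ → ℝ} {g'' t : ℝ} (hg : ∀ s, HasDerivAt g (g' s) s)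
    (hg' : HasDerivAt g' g'' t) (ht : g t ≠ 0) :
    deriv (deriv fun s => Real.log (g s)) t = (g t * g'' - g' t ^ 2) / g t ^ 2 := by
  have heq : deriv (fun s => Real.log (g s)) =ᶠ[nhds t] fun s => g' s / g s := by
    filter_upwards [(hg t).continuousAt.eventually_ne ht] with s hs
    exact ((hg s).log hs).deriv
  rw [heq.deriv_eq, (hg'.fun_div (hg t) ht).deriv]
  ring

/-- Toda lattice equation for Hankel (double Wronskian) determinants
`σ_n(t) = det[f^{(i+j)}(t)]_{i,j=0,…,n-1}`:
`σ_n σ_n'' - (σ_n')² = σ_{n+1} σ_{n-1}`, equivalently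
`(log σ_n)'' = σ_{n+1}σ_{n-1}/σ_n²` where `σ_n ≠ 0`. -/
theorem hankel_determinant_toda
    (f : ℝ → ℝ) (hf : ContDiff ℝ (⊤ : ℕ∞) f)
    (σ : ℕ → ℝ → ℝ)
    (hσ : ∀ n t, σ n t
        = Matrix.det (Matrix.of fun i j : Fin n => iteratedDeriv ((i : ℕ) + (j : ℕ)) f t)) :
    ∀ n : ℕ, 1 ≤ n → ∀ t : ℝ,
      (σ n t * deriv (deriv (σ n)) t - (deriv (σ n) t) ^ 2 = σ (n + 1) t * σ (n - 1) t)
      ∧ (σ n t ≠ 0 →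
          deriv (deriv fun s => Real.log (σ n s)) t
            = σ (n + 1) t * σ (n - 1) t / (σ n t) ^ 2) := by
  intro n hn t
  obtain ⟨m, rfl⟩ := Nat.exists_eq_add_of_le' hn
  let s : Fin (m + 1) → ℕ := fun i => (Fin.last m).castSucc.succAbove i
  have hσm : σ (m + 1) = hankelMinor f Fin.val Fin.val := funext (hσ (m + 1))
  have h₁ (u : ℝ) : HasDerivAt (σ (m + 1)) (hankelMinor f Fin.val s u) u := by
    rw [hσm, hankelMinor_comm f Fin.val s]
    exact hasDerivAt_hankelMinor_val hf _ u
  have h₂ : HasDerivAt (hankelMinor f Fin.val s) (hankelMinor f s s t) t :=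
    hasDerivAt_hankelMinor_val hf s t
  have hdj : σ (m + 1) t * hankelMinor f s s t - hankelMinor f Fin.val s t ^ 2 =
      σ (m + 1 + 1) t * σ (m + 1 - 1) t := by
    have h := desnanot_jacobi
      (Matrix.of fun i j : Fin (m + 2) => iteratedDeriv ((i : ℕ) + (j : ℕ)) f t)
    rw [sq]
    nth_rw 2 [hankelMinor_comm f Fin.val s]
    rw [hσ, hσ, hσ]
    exact h
  refine ⟨?_, fun ht => ?_⟩
  · rw [funext fun u => (h₁ u).deriv, h₂.deriv, hdj]
  · rw [deriv_deriv_log_comp h₁ h₂ ht, hdj]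
end

section
/- For a real number a > −1, define I_a(t) := ∫_{−∞}^t (t − x)^a e^{−x²} dx for t ∈ ℝ. Then for every real a > 1, the function I_a is twice differentiable and satisfies the Hermite–Weber equation I_a''(t) + 2t·I_a'(t) − 2a·I_a(t) = 0 for all t ∈ ℝ. -/
open MeasureTheory Set Filter Topology

/-- The incomplete Gaussian moment after the substitution `u = t - x`. -/
noncomputable def shiftedGaussianMoment (a t : ℝ) : ℝ :=
  ∫ u in Ioi (0 : ℝ), u ^ a * Real.exp (-(t - u) ^ 2)

lemma setIntegral_Iic_eq_shiftedGaussianMoment (a t : ℝ) :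
    ∫ x in Iic t, (t - x) ^ a * Real.exp (-x ^ 2) = shiftedGaussianMoment a t := by
  rw [shiftedGaussianMoment, integral_Iic_eq_integral_Iio, ← integral_indicator measurableSet_Iio,
    ← integral_indicator measurableSet_Ioi, ← integral_sub_left_eq_self _ volume t]
  congr 1 with u
  simp [indicator]

lemma exp_neg_sub_sq_le {R t : ℝ} (ht : |t| ≤ R) (u : ℝ) :
    Real.exp (-(t - u) ^ 2) ≤ Real.exp (2 * R ^ 2) * Real.exp (-(1 / 2) * u ^ 2) := by
  rw [← Real.exp_add, Real.exp_le_exp]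
  have : t ^ 2 ≤ R ^ 2 := sq_le_sq' (abs_le.1 ht).1 (abs_le.1 ht).2
  nlinarith [sq_nonneg (2 * t - u)]

lemma integrableOn_rpow_mul_exp_neg_sub_sq {a : ℝ} (ha : -1 < a) (t : ℝ) :
    IntegrableOn (fun u : ℝ => u ^ a * Real.exp (-(t - u) ^ 2)) (Ioi 0) := by
  refine ((integrableOn_rpow_mul_exp_neg_mul_sq (b := 1 / 2) (by norm_num) ha).const_mul
    (Real.exp (2 * |t| ^ 2))).mono' (by fun_prop) ?_
  filter_upwards [ae_restrict_mem measurableSet_Ioi] with u hu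
  have hpow : 0 ≤ u ^ a := Real.rpow_nonneg (le_of_lt hu) a
  rw [Real.norm_of_nonneg (by positivity), mul_left_comm]
  exact mul_le_mul_of_nonneg_left (exp_neg_sub_sq_le le_rfl u) hpow

lemma hasDerivAt_shiftedGaussianMoment {a : ℝ} (ha : -1 < a) (t : ℝ) :
    HasDerivAt (shiftedGaussianMoment a)
      (2 * shiftedGaussianMoment (a + 1) t - 2 * t * shiftedGaussianMoment a t) t := by
  have h_int := integrableOn_rpow_mul_exp_neg_sub_sq ha
  have h_succ_int := integrableOn_rpow_mul_exp_neg_sub_sq (a := a + 1) (by linarith)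
  have hg := integrableOn_rpow_mul_exp_neg_mul_sq (b := 1 / 2) (by norm_num) ha
  have hg' := integrableOn_rpow_mul_exp_neg_mul_sq (b := 1 / 2) (s := a + 1) (by norm_num)
    (by linarith)
  set R := |t| + 1 with hR
  have key := (hasDerivAt_integral_of_dominated_loc_of_deriv_le
    (μ := volume.restrict (Ioi (0 : ℝ))) (x₀ := t) (s := Metric.ball t 1)
    (F := fun t u : ℝ => u ^ a * Real.exp (-(t - u) ^ 2))
    (F' := fun t u : ℝ => 2 * (u ^ (a + 1) * Real.exp (-(t - u) ^ 2))
      - 2 * t * (u ^ a * Real.exp (-(t - u) ^ 2)))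
    (bound := fun u : ℝ => 2 * Real.exp (2 * R ^ 2) * (u ^ (a + 1) * Real.exp (-(1 / 2) * u ^ 2))
      + 2 * R * Real.exp (2 * R ^ 2) * (u ^ a * Real.exp (-(1 / 2) * u ^ 2)))
    (Metric.ball_mem_nhds t one_pos)
    (Eventually.of_forall fun s => (h_int s).aestronglyMeasurable) (h_int t)
    (((h_succ_int t).const_mul 2).sub ((h_int t).const_mul (2 * t))).aestronglyMeasurable
    ?_ ((hg'.const_mul _).add (hg.const_mul _)) ?_).2
  · rw [integral_sub ((h_succ_int t).const_mul 2) ((h_int t).const_mul (2 * t)),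
      integral_const_mul, integral_const_mul] at key
    exact key
  · filter_upwards [ae_restrict_mem measurableSet_Ioi] with u hu s hs
    have hpow : 0 ≤ u ^ a := Real.rpow_nonneg (le_of_lt hu) a
    have hpow' : 0 ≤ u ^ (a + 1) := Real.rpow_nonneg (le_of_lt hu) (a + 1)
    have hsR : |s| ≤ R := by
      rw [Metric.mem_ball, Real.dist_eq] at hs
      have := abs_sub_abs_le_abs_sub s t
      linarith
    have hexp := exp_neg_sub_sq_le hsR u
    refine (norm_sub_le _ _).trans ?_
    simp only [norm_mul, Real.norm_eq_abs, abs_of_nonneg hpow, abs_of_nonneg hpow', Real.abs_exp,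
      abs_two]
    calc 2 * (u ^ (a + 1) * Real.exp (-(s - u) ^ 2)) + 2 * |s| * (u ^ a * Real.exp (-(s - u) ^ 2))
        ≤ 2 * (u ^ (a + 1) * (Real.exp (2 * R ^ 2) * Real.exp (-(1 / 2) * u ^ 2)))
          + 2 * R * (u ^ a * (Real.exp (2 * R ^ 2) * Real.exp (-(1 / 2) * u ^ 2))) := by gcongr
      _ = _ := by ring
  · filter_upwards [ae_restrict_mem measurableSet_Ioi] with u hu s _
    have h := ((((hasDerivAt_id s).sub_const u).pow 2).neg.exp).const_mul (u ^ a)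
    refine h.congr_deriv ?_
    rw [Real.rpow_add_one (ne_of_gt hu)]
    simp
    ring

/-- Integration by parts. -/
lemma shiftedGaussianMoment_recurrence {a : ℝ} (ha : 0 < a) (t : ℝ) :
    2 * shiftedGaussianMoment (a + 1) t - 2 * t * shiftedGaussianMoment a t
      = a * shiftedGaussianMoment (a - 1) t := by
  have h_int := integrableOn_rpow_mul_exp_neg_sub_sq (a := a) (by linarith) t
  have h_succ_int := integrableOn_rpow_mul_exp_neg_sub_sq (a := a + 1) (by linarith) t
  have h_pred_int := integrableOn_rpow_mul_exp_neg_sub_sq (a := a - 1) (by linarith) t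
  have hderiv : ∀ u ∈ Ioi (0 : ℝ), HasDerivAt (fun u : ℝ => u ^ a * Real.exp (-(t - u) ^ 2))
      (a * (u ^ (a - 1) * Real.exp (-(t - u) ^ 2))
        - (2 * (u ^ (a + 1) * Real.exp (-(t - u) ^ 2))
          - 2 * t * (u ^ a * Real.exp (-(t - u) ^ 2)))) u := by
    intro u hu
    have h := (Real.hasDerivAt_rpow_const (p := a) (Or.inl (ne_of_gt hu))).mul
      ((((hasDerivAt_id u).const_sub t).pow 2).neg.exp)
    refine h.congr_deriv ?_
    rw [Real.rpow_add_one (ne_of_gt hu)]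
    simp
    ring
  have h_diff_int : IntegrableOn (fun u : ℝ => 2 * (u ^ (a + 1) * Real.exp (-(t - u) ^ 2))
      - 2 * t * (u ^ a * Real.exp (-(t - u) ^ 2))) (Ioi 0) :=
    (h_succ_int.const_mul 2).sub (h_int.const_mul (2 * t))
  have h_deriv_int := (h_pred_int.const_mul a).sub h_diff_int
  have hcont : ContinuousWithinAt (fun u : ℝ => u ^ a * Real.exp (-(t - u) ^ 2)) (Ici 0) 0 :=
    ((Real.continuous_rpow_const ha.le).mul (by fun_prop)).continuousWithinAt
  have hftc := integral_Ioi_of_hasDerivAt_of_tendsto hcont hderiv h_deriv_int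
    (tendsto_zero_of_hasDerivAt_of_integrableOn_Ioi hderiv h_deriv_int h_int)
  rw [integral_sub (h_pred_int.const_mul a) h_diff_int,
    integral_sub (h_succ_int.const_mul 2) (h_int.const_mul (2 * t)), integral_const_mul,
    integral_const_mul, integral_const_mul, Real.zero_rpow ha.ne'] at hftc
  simp only [shiftedGaussianMoment]
  linarith

/-- The incomplete Gaussian moment function `I_a(t) = ∫_{-∞}^t (t-x)^a e^{-x²} dx`
satisfies, for `a > 1`, the Hermite–Weber equation `I_a'' + 2t I_a' - 2a I_a = 0`. -/
theorem incomplete_gaussian_moment_hermite_weber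
    (I : ℝ → ℝ → ℝ)
    (hI : ∀ a t, I a t = ∫ x in Set.Iic t, (t - x) ^ a * Real.exp (-x ^ 2)) :
    ∀ a : ℝ, 1 < a →
      Differentiable ℝ (I a) ∧ Differentiable ℝ (deriv (I a)) ∧
      ∀ t, deriv (deriv (I a)) t + 2 * t * deriv (I a) t - 2 * a * I a t = 0 := by
  intro a ha
  have hI' (b : ℝ) : I b = shiftedGaussianMoment b :=
    funext fun t => (hI b t).trans (setIntegral_Iic_eq_shiftedGaussianMoment b t)
  have hderiv {b : ℝ} (hb : 0 < b) (t : ℝ) : HasDerivAt (I b) (b * I (b - 1) t) t := by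
    rw [hI', hI', ← shiftedGaussianMoment_recurrence hb]
    exact hasDerivAt_shiftedGaussianMoment (by linarith) t
  have hderiv_eq : deriv (I a) = fun t => a * I (a - 1) t :=
    funext fun t => (hderiv (by linarith) t).deriv
  have hderiv2 (t : ℝ) : HasDerivAt (deriv (I a)) (a * ((a - 1) * I (a - 1 - 1) t)) t := by
    rw [hderiv_eq]
    exact (hderiv (by linarith) t).const_mul a
  refine ⟨fun t => (hderiv (by linarith) t).differentiableAt,
    fun t => (hderiv2 t).differentiableAt, fun t => ?_⟩
  have hrec := shiftedGaussianMoment_recurrence (a := a - 1) (by linarith) t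
  rw [sub_add_cancel] at hrec
  rw [(hderiv2 t).deriv, hderiv_eq, hI', hI', hI']
  linear_combination -a * hrec
end

section
/- For a real number a > −1, define I_a(t) := ∫_{−∞}^t (t − x)^a e^{−x²} dx for t ∈ ℝ. Then for every real a > 1 and every t ∈ ℝ, the three-term recurrence I_a(t) = t·I_{a−1}(t) + ((a − 1)/2)·I_{a−2}(t) holds. -/
open MeasureTheory Set

/-- The integrand of the incomplete Gaussian moment function is integrable when `-1 < a`. -/
lemma integrableOn_sub_rpow_mul_exp_neg_sq {a : ℝ} (ha : -1 < a) (t : ℝ) :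
    IntegrableOn (fun x : ℝ => (t - x) ^ a * Real.exp (-x ^ 2)) (Iic t) := by
  have hdom : Integrable fun x : ℝ =>
      Real.exp (t ^ 2) * ((t - x) ^ a * Real.exp (-(1 / 2) * (t - x) ^ 2)) :=
    ((integrable_rpow_mul_exp_neg_mul_sq (by norm_num) ha).comp_sub_left t).const_mul _
  refine Integrable.mono' hdom.integrableOn (by fun_prop) ?_
  refine (ae_restrict_mem measurableSet_Iic).mono fun x (hx : x ≤ t) => ?_
  have hpow : 0 ≤ (t - x) ^ a := Real.rpow_nonneg (sub_nonneg.2 hx) a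
  rw [Real.norm_of_nonneg (mul_nonneg hpow (Real.exp_pos _).le), mul_left_comm, ← Real.exp_add]
  gcongr
  nlinarith [sq_nonneg (t + x)]

lemma hasDerivAt_sub_rpow_mul_exp_neg_sq (a : ℝ) {t x : ℝ} (hx : x < t) :
    HasDerivAt (fun x : ℝ => (t - x) ^ (a - 1) * Real.exp (-x ^ 2))
      (2 * ((t - x) ^ a * Real.exp (-x ^ 2))
        - 2 * t * ((t - x) ^ (a - 1) * Real.exp (-x ^ 2))
        - (a - 1) * ((t - x) ^ (a - 2) * Real.exp (-x ^ 2))) x := by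
  have hpos : 0 < t - x := sub_pos.2 hx
  have hpow := ((hasDerivAt_id x).const_sub t).rpow_const (p := a - 1) (Or.inl hpos.ne')
  have hexp := ((hasDerivAt_id x).pow 2).neg.exp
  have hsplit : (t - x) ^ a = (t - x) ^ (a - 1) * (t - x) := by
    rw [← Real.rpow_add_one hpos.ne', sub_add_cancel]
  refine (hpow.mul hexp).congr_deriv ?_
  simp only [id, hsplit, Pi.pow_apply, Pi.neg_apply, show a - 1 - 1 = a - 2 by ring]
  push_cast
  ring

/-- Three-term recurrence for the incomplete Gaussian moment function
`I_a(t) = ∫_{-∞}^t (t-x)^a e^{-x²} dx`: for `a > 1`,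
`I_a(t) = t I_{a-1}(t) + ((a-1)/2) I_{a-2}(t)`. -/
theorem incomplete_gaussian_moment_recurrence
    (I : ℝ → ℝ → ℝ)
    (hI : ∀ a t, I a t = ∫ x in Set.Iic t, (t - x) ^ a * Real.exp (-x ^ 2)) :
    ∀ a : ℝ, 1 < a → ∀ t : ℝ,
      I a t = t * I (a - 1) t + ((a - 1) / 2) * I (a - 2) t := by
  intro a ha t
  have h₀ := (integrableOn_sub_rpow_mul_exp_neg_sq (a := a) (by linarith) t).const_mul 2
  have hF := integrableOn_sub_rpow_mul_exp_neg_sq (a := a - 1) (by linarith) t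
  have h₁ := hF.const_mul (2 * t)
  have h₂ := (integrableOn_sub_rpow_mul_exp_neg_sq (a := a - 2) (by linarith) t).const_mul (a - 1)
  have hderiv : ∀ x ∈ Iio t, HasDerivAt _ _ x :=
    fun x hx => hasDerivAt_sub_rpow_mul_exp_neg_sq a hx
  have hF' := (h₀.sub h₁).sub h₂
  have hsub : Iic (t - 1) ⊆ Iio t := Iic_subset_Iio.2 (sub_one_lt t)
  have hlim := tendsto_zero_of_hasDerivAt_of_integrableOn_Iic
    (fun x hx => hderiv x (hsub hx)) (IntegrableOn.mono_set hF' (hsub.trans Iio_subset_Iic_self))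
    (hF.mono_set (hsub.trans Iio_subset_Iic_self))
  have hcont : Continuous fun x : ℝ => (t - x) ^ (a - 1) * Real.exp (-x ^ 2) :=
    ((continuous_const.sub continuous_id).rpow_const fun _ => Or.inr (by linarith)).mul
      (by fun_prop)
  have key := integral_Iic_of_hasDerivAt_of_tendsto hcont.continuousWithinAt hderiv hF' hlim
  rw [integral_sub (by exact h₀.sub h₁) h₂, integral_sub h₀ h₁, integral_const_mul,
    integral_const_mul, integral_const_mul, ← hI, ← hI, ← hI, sub_self t,
    Real.zero_rpow (by linarith)] at key
  linarith
end

section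
/- For every nonnegative integer p and every real t, the complex integral identity ∫_{−∞}^{∞} (t − ix)^p e^{−x²} dx = √π · 2^{−p} · H_p(t) holds, where H_p denotes the physicists' Hermite polynomial of degree p. -/
open MeasureTheory Complex

theorem iteratedDeriv_one_exp_neg_sq :
    iteratedDeriv 1 (fun s : ℝ => Real.exp (-s ^ 2)) = fun t => -2 * t * Real.exp (-t ^ 2) := by
  funext t
  rw [iteratedDeriv_one, (((hasDerivAt_pow 2 t).fun_neg).exp).deriv]
  ring

/-- Each derivative of the Gaussian `s ↦ e^{-s²}` is determined by the previous two. -/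
theorem iteratedDeriv_exp_neg_sq_add_two (n : ℕ) (t : ℝ) :
    iteratedDeriv (n + 2) (fun s : ℝ => Real.exp (-s ^ 2)) t
      = -2 * t * iteratedDeriv (n + 1) (fun s : ℝ => Real.exp (-s ^ 2)) t
        - 2 * (n + 1) * iteratedDeriv n (fun s : ℝ => Real.exp (-s ^ 2)) t := by
  set g : ℝ → ℝ := fun s => Real.exp (-s ^ 2)
  have hsmooth : ContDiff ℝ ⊤ g := by fun_prop
  have hderiv (n : ℕ) (t : ℝ) :
      HasDerivAt (iteratedDeriv n g) (iteratedDeriv (n + 1) g t) t := by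
    rw [iteratedDeriv_succ]
    exact ((hsmooth.differentiable_iteratedDeriv n (by simp)) t).hasDerivAt
  induction n generalizing t with
  | zero =>
    have hone : iteratedDeriv 1 g = fun s => -2 * s * g s := iteratedDeriv_one_exp_neg_sq
    have h := ((hasDerivAt_id t).const_mul (-2)).mul (hderiv 0 t)
    rw [zero_add, iteratedDeriv_succ, hone]
    simp only [iteratedDeriv_zero, zero_add, hone] at h ⊢
    refine (h.congr_deriv ?_).deriv
    simp
    ring
  | succ n ih =>
    have h := (((hasDerivAt_id t).const_mul (-2)).mul (hderiv (n + 1) t)).sub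
      ((hderiv n t).const_mul (2 * ((n : ℝ) + 1)))
    have hfun : iteratedDeriv (n + 2) g = fun s =>
        -2 * s * iteratedDeriv (n + 1) g s - 2 * (n + 1) * iteratedDeriv n g s := funext ih
    have hstep := hderiv (n + 2) t
    rw [hfun] at hstep
    refine (hstep.unique h).trans ?_
    push_cast [id]
    ring

theorem integrable_pow_mul_cexp_neg_sq (k : ℕ) :
    Integrable fun x : ℝ => (x : ℂ) ^ k * cexp (-(x : ℂ) ^ 2) := by
  have h := integrable_rpow_mul_exp_neg_mul_sq one_pos
    (show (-1 : ℝ) < k by linarith [k.cast_nonneg (α := ℝ)])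
  refine h.ofReal.congr (.of_forall fun x => ?_)
  simp

theorem integrable_sub_I_mul_pow_mul_cexp_neg_sq (t : ℂ) (p : ℕ) :
    Integrable fun x : ℝ => (t - I * x) ^ p * cexp (-(x : ℂ) ^ 2) := by
  suffices h : ∀ k : ℕ, Integrable fun x : ℝ =>
      (t - I * x) ^ p * ((x : ℂ) ^ k * cexp (-(x : ℂ) ^ 2)) by simpa using h 0
  induction p with
  | zero => simpa using integrable_pow_mul_cexp_neg_sq
  | succ p ih =>
    intro k
    refine (((ih k).const_mul t).sub ((ih (k + 1)).const_mul I)).congr (.of_forall fun x => ?_)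
    simp only [Pi.sub_apply]
    ring

/-- Integration by parts for the moments `∫ (t - ix)^p e^{-x²} dx`. -/
theorem integral_sub_I_mul_pow_succ (t : ℂ) (p : ℕ) :
    ∫ x : ℝ, (t - I * x) ^ (p + 1) * cexp (-(x : ℂ) ^ 2)
      = t * (∫ x : ℝ, (t - I * x) ^ p * cexp (-(x : ℂ) ^ 2))
        - p / 2 * ∫ x : ℝ, (t - I * x) ^ (p - 1) * cexp (-(x : ℂ) ^ 2) := by
  have hmoment := integrable_sub_I_mul_pow_mul_cexp_neg_sq t
  have hderiv (x : ℝ) : HasDerivAt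
      (fun x : ℝ => I / 2 * ((t - I * x) ^ p * cexp (-(x : ℂ) ^ 2)))
      ((t - I * x) ^ (p + 1) * cexp (-(x : ℂ) ^ 2)
        - (t * ((t - I * x) ^ p * cexp (-(x : ℂ) ^ 2))
          - p / 2 * ((t - I * x) ^ (p - 1) * cexp (-(x : ℂ) ^ 2)))) x := by
    have hx : HasDerivAt (fun x : ℝ => (x : ℂ)) 1 x := ofRealCLM.hasDerivAt
    have h := ((((hx.const_mul I).const_sub t).fun_pow p).fun_mul
      ((hx.fun_pow 2).fun_neg).cexp).const_mul (I / 2)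
    refine h.congr_deriv ?_
    linear_combination (-p / 2 * (t - I * x) ^ (p - 1) * cexp (-(x : ℂ) ^ 2)) * I_sq
  have hrest : Integrable fun x : ℝ => t * ((t - I * x) ^ p * cexp (-(x : ℂ) ^ 2))
      - p / 2 * ((t - I * x) ^ (p - 1) * cexp (-(x : ℂ) ^ 2)) :=
    ((hmoment p).const_mul t).sub ((hmoment (p - 1)).const_mul _)
  have h := integral_eq_zero_of_hasDerivAt_of_integrable hderiv ((hmoment (p + 1)).sub hrest)
    ((hmoment p).const_mul _)
  rw [integral_sub (hmoment (p + 1)) hrest,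
    integral_sub ((hmoment p).const_mul t) ((hmoment (p - 1)).const_mul _),
    integral_const_mul, integral_const_mul] at h
  exact sub_eq_zero.mp h

theorem integral_cexp_neg_sq : ∫ x : ℝ, cexp (-(x : ℂ) ^ 2) = (√Real.pi : ℂ) := by
  have h := congrArg ((↑) : ℝ → ℂ) (integral_gaussian 1)
  rw [← integral_complex_ofReal] at h
  simpa using h

/-- `∫_{-∞}^∞ (t - ix)^p e^{-x²} dx = √π 2^{-p} H_p(t)` where `H_p` is the
physicists' Hermite polynomial, given by the Rodrigues formula
`H_p(t) = (-1)^p e^{t²} (d/dt)^p e^{-t²}`. -/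
theorem complex_gaussian_integral_hermite
    (H : ℕ → ℝ → ℝ)
    (hH : ∀ p t, H p t
        = (-1) ^ p * Real.exp (t ^ 2) * iteratedDeriv p (fun s => Real.exp (-s ^ 2)) t) :
    ∀ (p : ℕ) (t : ℝ),
      (∫ x : ℝ, ((t : ℂ) - Complex.I * (x : ℂ)) ^ p * Complex.exp (-(x : ℂ) ^ 2))
        = (Real.sqrt Real.pi : ℂ) * (2 : ℂ) ^ (-(p : ℤ)) * (H p t : ℂ) := by
  intro p t
  induction p using Nat.twoStepInduction with
  | zero => simp [hH, integral_cexp_neg_sq, ← Real.exp_add]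
  | one =>
    have hone : H 1 t = 2 * t := by
      rw [hH, iteratedDeriv_one_exp_neg_sq]
      simp only [Real.exp_neg]
      field_simp
    have h := integral_sub_I_mul_pow_succ t 0
    simp only [zero_add, pow_zero, one_mul, integral_cexp_neg_sq, Nat.cast_zero, zero_div,
      zero_mul, sub_zero] at h
    rw [h, hone]
    simp
    ring
  | more p ih₀ ih₁ =>
    have hrec : H (p + 2) t = 2 * t * H (p + 1) t - 2 * (p + 1) * H p t := by
      rw [hH, hH, hH, iteratedDeriv_exp_neg_sq_add_two]
      ring
    rw [integral_sub_I_mul_pow_succ, Nat.add_sub_cancel, ih₀, ih₁, hrec]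
    simp only [zpow_neg, zpow_natCast]
    push_cast
    field_simp
    ring
end

section
/- Let N and a be positive integers and define c(M) := ∫_{ℝ^M} ∏_{j=1}^M e^{−x_j²} ∏_{1≤j<k≤M}(x_k − x_j)² dx₁⋯dx_M for any positive integer M. Then for all real λ the duality identity holds: (1/c(N)) ∫_{ℝ^N} ∏_{j=1}^N e^{−x_j²}(λ − x_j)^a ∏_{1≤j<k≤N}(x_k − x_j)² dx₁⋯dx_N = (1/c(a)) ∫_{ℝ^a} ∏_{j=1}^a e^{−x_j²}(λ − i x_j)^N ∏_{1≤j<k≤a}(x_k − x_j)² dx₁⋯dx_a, where i is the imaginary unit and the right-hand side is a complex integral (which is in fact real). -/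
open MeasureTheory

namespace GaussianDuality

open Polynomial

/-- A polynomial times the Gaussian weight is integrable on the real line. -/
theorem integrable_cexp_neg_sq_mul_eval (p : ℂ[X]) :
    Integrable fun x : ℝ => Complex.exp (-(x : ℂ) ^ 2) * p.eval (x : ℂ) := by
  induction p using Polynomial.induction_on' with
  | add p q hp hq => simpa [mul_add] using! hp.add hq
  | monomial n c =>
    have h := integrable_rpow_mul_exp_neg_mul_sq (b := 1) one_pos (s := n)
      (by have := n.cast_nonneg (α := ℝ); linarith)
    convert! (h.ofReal (𝕜 := ℂ)).const_mul c using 2 with x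
    simp
    ring

/-- The moment functional of the Gaussian weight `exp (-x ^ 2)`. -/
noncomputable def moment : ℂ[X] →ₗ[ℂ] ℂ where
  toFun p := ∫ x : ℝ, Complex.exp (-(x : ℂ) ^ 2) * p.eval (x : ℂ)
  map_add' p q := by
    simp only [eval_add, mul_add]
    exact integral_add (integrable_cexp_neg_sq_mul_eval p) (integrable_cexp_neg_sq_mul_eval q)
  map_smul' c p := by
    simp only [eval_smul, smul_eq_mul, mul_left_comm _ c, RingHom.id_apply]
    exact integral_const_mul c _

theorem moment_apply (p : ℂ[X]) :
    moment p = ∫ x : ℝ, Complex.exp (-(x : ℂ) ^ 2) * p.eval (x : ℂ) := rfl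

theorem moment_C_mul (c : ℂ) (p : ℂ[X]) : moment (C c * p) = c * moment p := by
  rw [← smul_eq_C_mul, map_smul, smul_eq_mul]

theorem moment_one_ne_zero : moment 1 ≠ 0 := by
  have h := integral_gaussian_complex (b := 1) (by simp)
  simp only [moment_apply, eval_one, mul_one]
  simp only [neg_mul, one_mul] at h
  rw [h, Ne, Complex.cpow_eq_zero_iff]
  simp [Real.pi_ne_zero]

/-- Integration by parts against the Gaussian weight. -/
theorem moment_X_mul (p : ℂ[X]) : moment (X * p) = 2⁻¹ * moment (derivative p) := by
  have hd : ∀ x : ℝ, HasDerivAt (fun x : ℝ => Complex.exp (-(x : ℂ) ^ 2) * p.eval (x : ℂ))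
      (Complex.exp (-(x : ℂ) ^ 2) * (derivative p - C 2 * (X * p)).eval (x : ℂ)) x := by
    intro x
    have h1 : HasDerivAt (fun z : ℂ => Complex.exp (-z ^ 2))
        (Complex.exp (-(x : ℂ) ^ 2) * (-(2 * (x : ℂ)))) x := by
      simpa using ((hasDerivAt_pow 2 (x : ℂ)).neg).cexp
    convert! (h1.mul (p.hasDerivAt (x : ℂ))).comp_ofReal using 1
    simp
    ring
  have h := integral_eq_zero_of_hasDerivAt_of_integrable hd
    (integrable_cexp_neg_sq_mul_eval _) (integrable_cexp_neg_sq_mul_eval p)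
  rw [← moment_apply, map_sub, moment_C_mul] at h
  linear_combination -2⁻¹ * h

/-- Andréief's identity for the Gaussian weight. -/
theorem integral_prod_weight_mul_det_mul_det {n : ℕ} (W : ℂ[X]) (p q : Fin n → ℂ[X]) :
    ∫ x : Fin n → ℝ, (∏ j, Complex.exp (-(x j : ℂ) ^ 2) * W.eval (x j : ℂ)) *
        ((Matrix.of fun i j => (p i).eval (x j : ℂ)).det *
          (Matrix.of fun i j => (q i).eval (x j : ℂ)).det)
      = n.factorial * (Matrix.of fun i j => moment (W * p i * q j)).det := by
  have hint : ∀ σ τ : Equiv.Perm (Fin n), Integrable fun x : Fin n → ℝ =>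
      ∏ j, Complex.exp (-(x j : ℂ) ^ 2) * (W * p (σ j) * q (τ j)).eval (x j : ℂ) := by
    intro σ τ
    exact Integrable.fintype_prod
      (f := fun j (y : ℝ) => Complex.exp (-(y : ℂ) ^ 2) * (W * p (σ j) * q (τ j)).eval (y : ℂ))
      fun j => integrable_cexp_neg_sq_mul_eval _
  calc
    _ = ∫ x : Fin n → ℝ, ∑ τ : Equiv.Perm (Fin n), ∑ σ : Equiv.Perm (Fin n),
          ((Equiv.Perm.sign τ : ℤ) : ℂ) * (((Equiv.Perm.sign σ : ℤ) : ℂ) *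
            ∏ j, Complex.exp (-(x j : ℂ) ^ 2) * (W * p (σ j) * q (τ j)).eval (x j : ℂ)) := by
      congr 1 with x
      simp only [Matrix.det_apply', Matrix.of_apply, eval_mul, Finset.prod_mul_distrib]
      rw [Finset.sum_mul_sum, Finset.sum_comm]
      simp only [Finset.mul_sum]
      refine Finset.sum_congr rfl fun τ _ => Finset.sum_congr rfl fun σ _ => ?_
      ring
    _ = ∑ τ : Equiv.Perm (Fin n), ∑ σ : Equiv.Perm (Fin n),
          ((Equiv.Perm.sign τ : ℤ) : ℂ) * (((Equiv.Perm.sign σ : ℤ) : ℂ) *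
            ∏ j, moment (W * p (σ j) * q (τ j))) := by
      rw [integral_finsetSum]
      · refine Finset.sum_congr rfl fun τ _ => ?_
        rw [integral_finsetSum]
        · refine Finset.sum_congr rfl fun σ _ => ?_
          rw [integral_const_mul, integral_const_mul]
          congr 2
          exact integral_fintype_prod_volume_eq_prod (fun j (y : ℝ) =>
            Complex.exp (-(y : ℂ) ^ 2) * (W * p (σ j) * q (τ j)).eval (y : ℂ))
        · exact fun σ _ => ((hint σ τ).const_mul _).const_mul _
      · exact fun τ _ => integrable_finsetSum _ fun σ _ => ((hint σ τ).const_mul _).const_mul _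
    _ = ∑ τ : Equiv.Perm (Fin n), (Matrix.of fun i j => moment (W * p i * q j)).det := by
      refine Finset.sum_congr rfl fun τ _ => ?_
      rw [← Finset.mul_sum]
      have h := Matrix.det_permute' τ (Matrix.of fun i j => moment (W * p i * q j))
      rw [Matrix.det_apply'] at h
      simp only [Matrix.submatrix_apply, Matrix.of_apply, id] at h
      rw [h, ← mul_assoc, ← Int.cast_mul, ← Units.val_mul, Int.units_mul_self]
      simp
    _ = _ := by
      simp [Fintype.card_perm]

theorem integral_prod_weight_mul_sq_vandermonde {n : ℕ} (W : ℂ[X]) (p q : Fin n → ℂ[X])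
    (hp : ∀ i, (p i).Monic) (hpd : ∀ i, (p i).natDegree = i)
    (hq : ∀ i, (q i).Monic) (hqd : ∀ i, (q i).natDegree = i) :
    ∫ x : Fin n → ℝ, (∏ j, Complex.exp (-(x j : ℂ) ^ 2) * W.eval (x j : ℂ)) *
        ∏ j, ∏ k ∈ Finset.Ioi j, ((x k : ℂ) - (x j : ℂ)) ^ 2
      = n.factorial * (Matrix.of fun i j => moment (W * p i * q j)).det := by
  rw [← integral_prod_weight_mul_det_mul_det]
  congr 1 with x
  have key : ∀ r : Fin n → ℂ[X], (∀ i, (r i).Monic) → (∀ i, (r i).natDegree = i) →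
      (Matrix.of fun i j => (r i).eval (x j : ℂ)).det =
        ∏ j, ∏ k ∈ Finset.Ioi j, ((x k : ℂ) - (x j : ℂ)) := by
    intro r hr hrd
    rw [← Matrix.det_vandermonde,
      Matrix.det_eval_matrixOfPolynomials_eq_det_vandermonde _ r hrd hr, ← Matrix.det_transpose]
    rfl
  rw [key p hp hpd, key q hq hqd, ← sq]
  simp only [Finset.prod_pow]

/-- The raising operator of the monic Hermite polynomials for the weight `exp (-x ^ 2)`. -/
noncomputable def raising : Module.End ℂ ℂ[X] :=
  LinearMap.mulLeft ℂ X - (2⁻¹ : ℂ) • derivative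

theorem raising_apply (p : ℂ[X]) : raising p = X * p - C 2⁻¹ * derivative p := by
  simp [raising, smul_eq_C_mul]

/-- The monic Hermite polynomials, orthogonal for the weight `exp (-x ^ 2)`. -/
noncomputable def monicHermite (n : ℕ) : ℂ[X] := (raising ^ n) 1

theorem monicHermite_zero : monicHermite 0 = 1 := by simp [monicHermite]

theorem monicHermite_succ (n : ℕ) : monicHermite (n + 1) = raising (monicHermite n) := by
  simp [monicHermite, pow_succ']

theorem raising_pow_monicHermite (k n : ℕ) :
    (raising ^ k) (monicHermite n) = monicHermite (n + k) := by
  simp [monicHermite, add_comm n, pow_add]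

theorem derivative_monicHermite_succ (n : ℕ) :
    derivative (monicHermite (n + 1)) = C (n + 1 : ℂ) * monicHermite n := by
  induction n with
  | zero => simp [monicHermite_succ, monicHermite_zero, raising_apply]
  | succ n ih =>
    rw [monicHermite_succ (n + 1), raising_apply]
    simp only [derivative_sub, derivative_mul, derivative_X, derivative_C, ih]
    rw [monicHermite_succ n, raising_apply]
    simp only [map_add, map_natCast, map_one]
    push_cast
    ring

theorem monic_natDegree_monicHermite (n : ℕ) :
    (monicHermite n).Monic ∧ (monicHermite n).natDegree = n := by
  induction n with
  | zero => simp [monicHermite_zero]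
  | succ n ih =>
    obtain ⟨hm, hd⟩ := ih
    have hX : (X * monicHermite n).Monic := monic_X.mul hm
    have hXd : (X * monicHermite n).natDegree = n + 1 := by
      rw [natDegree_X_mul hm.ne_zero, hd]
    have hlt : (C (2⁻¹ : ℂ) * derivative (monicHermite n)).degree
        < (X * monicHermite n).degree := by
      rw [degree_eq_natDegree hX.ne_zero, hXd]
      rw [degree_C_mul (by norm_num)]
      refine degree_derivative_le.trans_lt ?_
      rw [degree_eq_natDegree hm.ne_zero, hd]
      exact_mod_cast n.lt_succ_self
    rw [monicHermite_succ, raising_apply]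
    exact ⟨hX.sub_of_left hlt,
      (natDegree_eq_of_degree_eq (degree_sub_eq_left_of_degree_lt hlt)).trans hXd⟩

theorem moment_raising_mul (p q : ℂ[X]) :
    moment (raising p * q) = 2⁻¹ * moment (p * derivative q) := by
  have h := moment_X_mul (p * q)
  rw [derivative_mul, map_add] at h
  rw [raising_apply, sub_mul, mul_assoc, mul_assoc, map_sub, h, moment_C_mul]
  ring

theorem moment_monicHermite_mul_of_lt {j k : ℕ} (h : j < k) :
    moment (monicHermite k * monicHermite j) = 0 := by
  induction k generalizing j with
  | zero => omega
  | succ k ih =>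
    rw [monicHermite_succ, moment_raising_mul]
    cases j with
    | zero => simp [monicHermite_zero]
    | succ j =>
      rw [derivative_monicHermite_succ, mul_left_comm, moment_C_mul, ih (by omega)]
      simp

theorem moment_monicHermite_mul_of_ne {j k : ℕ} (h : j ≠ k) :
    moment (monicHermite k * monicHermite j) = 0 := by
  rcases h.lt_or_gt with h | h
  · exact moment_monicHermite_mul_of_lt h
  · rw [mul_comm]
    exact moment_monicHermite_mul_of_lt h

theorem moment_monicHermite_mul_self_ne_zero (k : ℕ) :
    moment (monicHermite k * monicHermite k) ≠ 0 := by
  induction k with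
  | zero => simpa [monicHermite_zero] using moment_one_ne_zero
  | succ k ih =>
    nth_rw 1 [monicHermite_succ]
    rw [moment_raising_mul, derivative_monicHermite_succ, mul_left_comm, moment_C_mul]
    exact mul_ne_zero (by norm_num) (mul_ne_zero (by exact_mod_cast k.succ_ne_zero) ih)

/-- The Gaussian integral representation of the Hermite polynomials. -/
theorem moment_sub_I_mul_X_pow (z : ℂ) (n : ℕ) :
    moment ((C z - C Complex.I * X) ^ n) = moment 1 * (monicHermite n).eval z := by
  induction n using Nat.twoStepInduction with
  | zero => simp [monicHermite_zero]
  | one =>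
    have h := moment_X_mul 1
    simp only [derivative_one, map_zero, mul_zero, mul_one] at h
    have h1 : moment (C z) = z * moment 1 := by simpa using moment_C_mul z 1
    rw [pow_one, map_sub, moment_C_mul, h, h1, monicHermite_succ, monicHermite_zero, raising_apply]
    simp [mul_comm]
  | more n ih ih' =>
    have h := moment_X_mul ((C z - C Complex.I * X) ^ (n + 1))
    have hd : derivative ((C z - C Complex.I * X) ^ (n + 1)) =
        C (-Complex.I * (n + 1)) * (C z - C Complex.I * X) ^ n := by
      rw [derivative_pow_succ]
      simp
      ring
    rw [hd, moment_C_mul, ih] at h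
    rw [pow_succ', sub_mul, map_sub, mul_assoc, moment_C_mul, moment_C_mul, h, ih',
      monicHermite_succ (n + 1), raising_apply, derivative_monicHermite_succ]
    simp only [eval_sub, eval_mul, eval_X, eval_C]
    linear_combination (2⁻¹ * (n + 1) * moment 1 * (monicHermite n).eval z) * Complex.I_sq

/-- Evaluating `raising ^ k` at a zero of order at least `k` reads off the leading coefficient. -/
theorem eval_raising_pow_sub_pow_mul (z : ℂ) (k : ℕ) (q : ℂ[X]) :
    ((raising ^ k) ((X - C z) ^ k * q)).eval z = (-2⁻¹) ^ k * k.factorial * q.eval z := by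
  induction k generalizing q with
  | zero => simp
  | succ k ih =>
    have h : raising ((X - C z) ^ (k + 1) * q) = (X - C z) ^ k *
        ((X - C z) * X * q - C (2⁻¹ * (k + 1) : ℂ) * q - C (2⁻¹ : ℂ) * (X - C z) * derivative q) := by
      rw [raising_apply, derivative_mul, derivative_pow_succ]
      simp
      ring
    rw [pow_succ, Module.End.mul_apply, h, ih]
    simp [Nat.factorial_succ]
    ring

/-- The determinant of `n` functionals on a monic basis of the polynomials of degree less than `n`
does not depend on the basis. -/
theorem det_functional_monic {ι : Type*} [Fintype ι] [DecidableEq ι] {n : ℕ} (e : ι ≃ Fin n)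
    (Φ : ι → ℂ[X] →ₗ[ℂ] ℂ) (p : ℕ → ℂ[X]) (hp : ∀ i, (p i).Monic)
    (hpd : ∀ i, (p i).natDegree = i) :
    (Matrix.of fun s t => Φ s (p (e t))).det = (Matrix.of fun s t => Φ s (X ^ (e t : ℕ))).det := by
  have h := Matrix.det_matrixOfPolynomials (fun i : Fin n => p i) (fun i => hpd i) fun i => hp i
  rw [← Matrix.det_submatrix_equiv_self e] at h
  rw [← mul_one (Matrix.det (Matrix.of fun s t => Φ s (X ^ (e t : ℕ)))), ← h, ← Matrix.det_mul]
  congr 1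
  ext s t
  simp only [Matrix.of_apply, Matrix.mul_apply, Matrix.submatrix_apply]
  rw [e.sum_comp fun m : Fin n => Φ s (X ^ (m : ℕ)) * (p (e t)).coeff m,
    Fin.sum_univ_eq_sum_range fun m => Φ s (X ^ m) * (p (e t)).coeff m]
  conv_lhs => rw [(p (e t)).as_sum_range_C_mul_X_pow' (n := n) (by rw [hpd]; exact (e t).2)]
  rw [map_sum]
  refine Finset.sum_congr rfl fun m _ => ?_
  rw [← smul_eq_C_mul, map_smul, smul_eq_mul, mul_comm]

theorem exists_det_moment_eq (N a : ℕ) : ∃ K : ℂ, ∀ z : ℂ,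
    (Matrix.of fun i j : Fin N =>
        moment ((C z - X) ^ a * (monicHermite i) * (X - C z) ^ (j : ℕ))).det
      = K * (Matrix.of fun i j : Fin a => (monicHermite (N + j + i)).eval z).det := by
  let e₁ : Fin N ⊕ Fin a ≃ Fin (N + a) := finSumFinEquiv
  let e₂ : Fin N ⊕ Fin a ≃ Fin (N + a) :=
    (Equiv.sumComm _ _).trans (finSumFinEquiv.trans (finCongr (add_comm a N)))
  let σ : Equiv.Perm (Fin N ⊕ Fin a) := e₂.trans e₁.symm
  let d : ℂ := ∏ k : Fin a, (-2⁻¹) ^ (k : ℕ) * ((k : ℕ).factorial : ℂ)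
  have hd : d ≠ 0 := Finset.prod_ne_zero_iff.2 fun k _ =>
    mul_ne_zero (pow_ne_zero _ (by norm_num)) (by exact_mod_cast (k : ℕ).factorial_ne_zero)
  refine ⟨((Equiv.Perm.sign σ : ℤ) : ℂ) *
    (∏ k : Fin N, (-1) ^ a * moment (monicHermite k * monicHermite k)) * d⁻¹, fun z => ?_⟩
  let Φ : Fin N ⊕ Fin a → ℂ[X] →ₗ[ℂ] ℂ := Sum.elim
    (fun k => (-1 : ℂ) ^ a • moment ∘ₗ LinearMap.mulLeft ℂ (monicHermite k))
    (fun k => Polynomial.leval z ∘ₗ raising ^ (k : ℕ))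
  have hΦl : ∀ k p, Φ (Sum.inl k) p = (-1) ^ a * moment (monicHermite k * p) := fun _ _ => rfl
  have hΦr : ∀ k p, Φ (Sum.inr k) p = ((raising ^ (k : ℕ)) p).eval z := fun _ _ => rfl
  have hvanish : ∀ k i : ℕ, k < i → ((raising ^ k) ((X - C z) ^ i)).eval z = 0 := by
    intro k i hki
    obtain ⟨m, rfl⟩ := Nat.exists_eq_add_of_lt hki
    rw [add_assoc, pow_add, eval_raising_pow_sub_pow_mul]
    simp
  have hpow : (Matrix.of fun s t => Φ s ((X - C z) ^ (e₂ t : ℕ))).det =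
      (Matrix.of fun i j : Fin N =>
        moment ((C z - X) ^ a * (monicHermite i) * (X - C z) ^ (j : ℕ))).det * d := by
    have hT : (Matrix.of fun k i : Fin a => ((raising ^ (k : ℕ)) ((X - C z) ^ (i : ℕ))).eval z).det
        = d := by
      rw [Matrix.det_of_isLowerTriangular]
      · refine Finset.prod_congr rfl fun k _ => ?_
        simpa using eval_raising_pow_sub_pow_mul z k 1
      · intro k i hki
        exact hvanish k i hki
    rw [← hT, ← Matrix.det_fromBlocks_zero₂₁ _ (Matrix.of fun (k : Fin N) (i : Fin a) =>
      Φ (Sum.inl k) ((X - C z) ^ (i : ℕ)))]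
    congr 1
    ext (k | k) (i | i)
    · have hC : (C z - X) ^ a = C ((-1) ^ a) * (X - C z) ^ a := by
        rw [C_pow, ← mul_pow]
        simp
      simp only [Matrix.of_apply, hΦl, Matrix.fromBlocks_apply₁₁, e₂, Equiv.trans_apply,
        Equiv.sumComm_apply, Sum.swap_inl, finSumFinEquiv_apply_right, finCongr_apply,
        Fin.val_cast, Fin.val_natAdd]
      rw [hC, ← moment_C_mul]
      congr 1
      ring
    · simp [e₂]
    · simp only [Matrix.of_apply, hΦr, Matrix.fromBlocks_apply₂₁, Matrix.zero_apply]
      refine hvanish _ _ ?_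
      simp only [e₂, Equiv.trans_apply, Equiv.sumComm_apply, Sum.swap_inl,
        finSumFinEquiv_apply_right, finCongr_apply, Fin.val_cast, Fin.val_natAdd]
      omega
    · simp [hΦr, e₂]
  have hherm : (Matrix.of fun s t => Φ s (monicHermite (e₁ t : ℕ))).det =
      (∏ k : Fin N, (-1) ^ a * moment (monicHermite k * monicHermite k)) *
        (Matrix.of fun i j : Fin a => (monicHermite (N + j + i)).eval z).det := by
    rw [← Matrix.det_diagonal, ← Matrix.det_fromBlocks_zero₁₂ _ (Matrix.of
      fun (k : Fin a) (i : Fin N) => Φ (Sum.inr k) (monicHermite i))]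
    congr 1
    ext (k | k) (i | i)
    · simp only [Matrix.of_apply, hΦl, Matrix.fromBlocks_apply₁₁, e₁, finSumFinEquiv_apply_left,
        Fin.val_castAdd, Matrix.diagonal_apply]
      split_ifs with h
      · rw [h]
      · rw [moment_monicHermite_mul_of_ne fun h' => h (Fin.ext h'.symm), mul_zero]
    · simp only [Matrix.of_apply, hΦl, Matrix.fromBlocks_apply₁₂, e₁, finSumFinEquiv_apply_right,
        Fin.val_natAdd, Matrix.zero_apply]
      rw [moment_monicHermite_mul_of_ne (by omega), mul_zero]
    · simp [e₁]
    · simp [hΦr, e₁, raising_pow_monicHermite]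
  have hswap : (Matrix.of fun s t => Φ s ((X - C z) ^ (e₂ t : ℕ))).det =
      ((Equiv.Perm.sign σ : ℤ) : ℂ) * (Matrix.of fun s t => Φ s ((X - C z) ^ (e₁ t : ℕ))).det := by
    rw [← Matrix.det_permute']
    congr 1
    ext s t
    simp [σ]
  rw [det_functional_monic e₁ Φ (fun n => (X - C z) ^ n) (fun n => (monic_X_sub_C z).pow n)
    (fun n => by simp [(monic_X_sub_C z).natDegree_pow]), ← det_functional_monic e₁ Φ monicHermite
    (fun n => (monic_natDegree_monicHermite n).1) (fun n => (monic_natDegree_monicHermite n).2),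
    hherm, hpow] at hswap
  rw [← mul_inv_cancel_right₀ hd (Matrix.det _), hswap]
  ring

/-- The unnormalized average of `∏ (z - u x_j) ^ m` over the ensemble of `n` points. -/
noncomputable def average (u : ℂ) (m n : ℕ) (z : ℂ) : ℂ :=
  ∫ x : Fin n → ℝ, (∏ j, Complex.exp (-(x j : ℂ) ^ 2) * (z - u * (x j : ℂ)) ^ m) *
    ∏ j, ∏ k ∈ Finset.Ioi j, ((x k : ℂ) - (x j : ℂ)) ^ 2

theorem average_eq_det (u : ℂ) (m : ℕ) {n : ℕ} (z : ℂ) (p q : Fin n → ℂ[X])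
    (hp : ∀ i, (p i).Monic) (hpd : ∀ i, (p i).natDegree = i)
    (hq : ∀ i, (q i).Monic) (hqd : ∀ i, (q i).natDegree = i) :
    average u m n z = n.factorial *
      (Matrix.of fun i j => moment ((C z - C u * X) ^ m * p i * q j)).det := by
  rw [← integral_prod_weight_mul_sq_vandermonde _ p q hp hpd hq hqd]
  simp [average]

theorem average_zero_ne_zero (u : ℂ) (n : ℕ) (z : ℂ) : average u 0 n z ≠ 0 := by
  rw [average_eq_det u 0 z (fun i => monicHermite i) (fun i => monicHermite i)
    (fun n => (monic_natDegree_monicHermite n).1) (fun n => (monic_natDegree_monicHermite n).2)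
    (fun n => (monic_natDegree_monicHermite n).1) (fun n => (monic_natDegree_monicHermite n).2)]
  refine mul_ne_zero (by exact_mod_cast n.factorial_ne_zero) ?_
  have h : (Matrix.of fun i j : Fin n =>
      moment ((C z - C u * X) ^ 0 * monicHermite i * monicHermite j)) =
      Matrix.diagonal fun i : Fin n => moment (monicHermite i * monicHermite i) := by
    ext i j
    rw [Matrix.diagonal_apply]
    split_ifs with hij
    · simp [hij]
    · simpa using moment_monicHermite_mul_of_ne fun h' => hij (Fin.ext h'.symm)
  rw [h, Matrix.det_diagonal]
  exact Finset.prod_ne_zero_iff.2 fun k _ => moment_monicHermite_mul_self_ne_zero k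

theorem exists_average_one_eq (N a : ℕ) : ∃ K : ℂ, ∀ z : ℂ, average 1 a N z =
    K * (Matrix.of fun i j : Fin a => (monicHermite (N + j + i)).eval z).det := by
  obtain ⟨K, hK⟩ := exists_det_moment_eq N a
  refine ⟨N.factorial * K, fun z => ?_⟩
  rw [average_eq_det 1 a z (fun i => monicHermite i) (fun i => (X - C z) ^ (i : ℕ))
    (fun n => (monic_natDegree_monicHermite n).1) (fun n => (monic_natDegree_monicHermite n).2)
    (fun n => (monic_X_sub_C z).pow n) (fun n => by simp [(monic_X_sub_C z).natDegree_pow]),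
    mul_assoc, ← hK]
  simp

theorem exists_average_I_eq (N a : ℕ) : ∃ K : ℂ, ∀ z : ℂ, average Complex.I N a z =
    K * (Matrix.of fun i j : Fin a => (monicHermite (N + j + i)).eval z).det := by
  refine ⟨a.factorial * ((∏ i : Fin a, moment 1 * Complex.I ^ (i : ℕ)) *
    ∏ i : Fin a, Complex.I ^ (i : ℕ)), fun z => ?_⟩
  have hp : ∀ i : Fin a, ((X - C (-Complex.I * z)) ^ (i : ℕ)).Monic :=
    fun i => (monic_X_sub_C _).pow _
  have hpd : ∀ i : Fin a, ((X - C (-Complex.I * z)) ^ (i : ℕ)).natDegree = (i : ℕ) :=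
    fun i => by rw [(monic_X_sub_C _).natDegree_pow, natDegree_X_sub_C, mul_one]
  rw [average_eq_det Complex.I N z _ _ hp hpd hp hpd, mul_assoc, mul_assoc,
    ← Matrix.det_mul_row, ← Matrix.det_mul_column]
  congr 2
  ext i j
  have hX : X - C (-Complex.I * z) = C Complex.I * (C z - C Complex.I * X) := by
    have hI : C Complex.I * C Complex.I = (-1 : ℂ[X]) := by
      rw [← C_mul, Complex.I_mul_I, C_neg, C_1]
    simp only [C_mul, C_neg]
    linear_combination X * hI
  simp only [Matrix.of_apply, hX]
  rw [mul_assoc (moment 1), mul_left_comm (moment 1), mul_left_comm (moment 1),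
    ← moment_sub_I_mul_X_pow, ← moment_C_mul, ← moment_C_mul]
  congr 1
  simp only [C_pow, mul_pow]
  ring

theorem tendsto_average_div_pow (u : ℂ) (m n : ℕ) :
    Filter.Tendsto (fun r : ℝ => average u m n r / (r : ℂ) ^ (m * n)) Filter.atTop
      (nhds (average u 0 n 0)) := by
  have hX : ∀ i : Fin n, ((X : ℂ[X]) ^ (i : ℕ)).Monic := fun i => monic_X_pow _
  have hXd : ∀ i : Fin n, ((X : ℂ[X]) ^ (i : ℕ)).natDegree = i := fun i => natDegree_X_pow _
  let J : ℂ → ℂ := fun t => n.factorial * (Matrix.of fun i j : Fin n =>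
    moment ((1 - C t * (C u * X)) ^ m * X ^ (i : ℕ) * X ^ (j : ℕ))).det
  have hJ : Continuous J := by
    refine continuous_const.mul (Continuous.matrix_det ?_)
    refine continuous_matrix fun i j => ?_
    have : ∀ t : ℂ, moment ((1 - C t * (C u * X)) ^ m * X ^ (i : ℕ) * X ^ (j : ℕ)) =
        ∑ k ∈ Finset.range (m + 1), t ^ k * moment ((-1) ^ k * (C u * X) ^ k * (m.choose k : ℂ[X])
          * X ^ (i : ℕ) * X ^ (j : ℕ)) := by
      intro t
      rw [sub_eq_neg_add, add_pow, Finset.sum_mul, Finset.sum_mul, map_sum]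
      refine Finset.sum_congr rfl fun k _ => ?_
      rw [← moment_C_mul]
      congr 1
      rw [neg_pow, mul_pow, C_pow, one_pow]
      ring
    simp only [Matrix.of_apply, this]
    fun_prop
  have hJ0 : J 0 = average u 0 n 0 := by
    rw [average_eq_det u 0 0 _ _ hX hXd hX hXd]
    simp [J]
  rw [← hJ0]
  have hinv : Filter.Tendsto (fun r : ℝ => ((r⁻¹ : ℝ) : ℂ)) Filter.atTop (nhds 0) := by
    exact_mod_cast (Complex.continuous_ofReal.tendsto 0).comp tendsto_inv_atTop_zero
  refine ((hJ.tendsto 0).comp hinv).congr' ?_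
  filter_upwards [Filter.eventually_ne_atTop 0] with r hr
  have hr' : (r : ℂ) ≠ 0 := by exact_mod_cast hr
  rw [eq_div_iff (pow_ne_zero _ hr'), average_eq_det u m r _ _ hX hXd hX hXd]
  simp only [Function.comp_apply, J]
  rw [mul_assoc, mul_comm (Matrix.det _), pow_mul]
  congr 1
  have h := Matrix.det_smul (Matrix.of fun i j : Fin n => moment
    ((1 - C ((r⁻¹ : ℝ) : ℂ) * (C u * X)) ^ m * X ^ (i : ℕ) * X ^ (j : ℕ))) ((r : ℂ) ^ m)
  rw [Fintype.card_fin] at h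
  rw [← h]
  congr 1
  ext i j
  simp only [Matrix.smul_apply, Matrix.of_apply, smul_eq_mul]
  rw [← moment_C_mul, ← mul_assoc, ← mul_assoc, C_pow, ← mul_pow, mul_sub, mul_one, ← mul_assoc,
    ← C_mul, Complex.ofReal_inv, mul_inv_cancel₀ hr', C_1, one_mul]

theorem average_duality (N a : ℕ) (r : ℝ) :
    (average 1 0 N 0)⁻¹ * average 1 a N r
      = (average Complex.I 0 a 0)⁻¹ * average Complex.I N a r := by
  obtain ⟨K₁, h₁⟩ := exists_average_one_eq N a
  obtain ⟨K₂, h₂⟩ := exists_average_I_eq N a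
  have hK : K₂ * average 1 0 N 0 = K₁ * average Complex.I 0 a 0 := by
    refine tendsto_nhds_unique ((tendsto_average_div_pow 1 a N).const_mul K₂) ?_
    refine ((tendsto_average_div_pow Complex.I N a).const_mul K₁).congr fun s => ?_
    rw [h₁, h₂, mul_comm N a]
    ring
  have hN := average_zero_ne_zero 1 N 0
  have ha := average_zero_ne_zero Complex.I a 0
  rw [h₁, h₂]
  field_simp
  linear_combination
    -(Matrix.of fun i j : Fin a => (monicHermite (N + j + i)).eval (r : ℂ)).det * hK

end GaussianDuality

/-- Duality identity for GUE averages of powers of the characteristic polynomial: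
`F_N(λ;a)` normalized by `c(N)` equals `F_a(iλ;N)`-type complex integral normalized
by `c(a)`. -/
theorem F_duality (N a : ℕ) (hN : 0 < N) (ha : 0 < a)
    (c : ℕ → ℝ)
    (hc : ∀ M : ℕ, c M = ∫ x : Fin M → ℝ,
        (∏ j, Real.exp (-(x j) ^ 2)) * ∏ j, ∏ k ∈ Finset.Ioi j, (x k - x j) ^ 2)
    (lam : ℝ) :
    (((c N)⁻¹ * ∫ x : Fin N → ℝ,
        (∏ j, Real.exp (-(x j) ^ 2) * (lam - x j) ^ a)
          * ∏ j, ∏ k ∈ Finset.Ioi j, (x k - x j) ^ 2 : ℝ) : ℂ)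
      = ((c a : ℂ))⁻¹ * ∫ x : Fin a → ℝ,
          (∏ j, Complex.exp (-((x j : ℂ)) ^ 2) * ((lam : ℂ) - Complex.I * (x j : ℂ)) ^ N)
            * ∏ j, ∏ k ∈ Finset.Ioi j, ((x k : ℂ) - (x j : ℂ)) ^ 2 := by
  have hcM : ∀ (u : ℂ) (M : ℕ), (c M : ℂ) = GaussianDuality.average u 0 M 0 := by
    intro u M
    rw [hc, ← integral_complex_ofReal]
    simp [GaussianDuality.average]
  have hF : ((∫ x : Fin N → ℝ, (∏ j, Real.exp (-(x j) ^ 2) * (lam - x j) ^ a)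
      * ∏ j, ∏ k ∈ Finset.Ioi j, (x k - x j) ^ 2 : ℝ) : ℂ) =
      GaussianDuality.average 1 a N lam := by
    rw [← integral_complex_ofReal]
    simp [GaussianDuality.average]
  rw [Complex.ofReal_mul, Complex.ofReal_inv, hF, hcM 1 N, hcM Complex.I a]
  exact GaussianDuality.average_duality N a lam
end

section
/- For a positive integer N define G_N(s) := ∫_{(−∞,s]^N} ∏_{j=1}^N e^{−x_j²} ∏_{1≤j<k≤N}(x_k − x_j)² dx₁⋯dx_N (so G_N(s) > 0 for all s), and define R_N(s) := G_N'(s)/G_N(s), the logarithmic derivative of the GUE gap probability E_N(0;(s,∞)) = G_N(s)/lim_{u→∞}G_N(u). Then R_N is twice differentiable and satisfies the particular Jimbo–Miwa–Okamoto σ-form of the Painlevé IV equation (R_N''(s))² + 4(R_N'(s))²(R_N'(s) + 2N) − 4(s·R_N'(s) − R_N(s))² = 0 for all real s. -/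
open MeasureTheory

noncomputable section

open Polynomial Set Filter Topology

namespace TruncatedGaussian

theorem integrable_eval_mul_gaussian (p : ℝ[X]) :
    Integrable fun x : ℝ => p.eval x * Real.exp (-x ^ 2) := by
  induction p using Polynomial.induction_on' with
  | add p q hp hq => simpa [add_mul] using! hp.add hq
  | monomial n a =>
    have h := integrable_rpow_mul_exp_neg_mul_sq (b := 1) one_pos (s := (n : ℝ))
      (by linarith [(Nat.cast_nonneg n : (0 : ℝ) ≤ n)])
    simpa [mul_assoc] using h.const_mul a

/-- Integration of polynomials against the Gaussian weight `e^{-x²}` on `(-∞, s]`. -/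
def functional (s : ℝ) : ℝ[X] →ₗ[ℝ] ℝ where
  toFun p := ∫ x in Iic s, p.eval x * Real.exp (-x ^ 2)
  map_add' p q := by
    rw [← integral_add (integrable_eval_mul_gaussian p).integrableOn
      (integrable_eval_mul_gaussian q).integrableOn]
    simp [add_mul]
  map_smul' c p := by
    rw [RingHom.id_apply, smul_eq_mul, ← integral_const_mul]
    simp [mul_assoc]

theorem functional_apply (s : ℝ) (p : ℝ[X]) :
    functional s p = ∫ x in Iic s, p.eval x * Real.exp (-x ^ 2) := rfl

theorem functional_C_mul (s c : ℝ) (p : ℝ[X]) : functional s (C c * p) = c * functional s p := by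
  rw [← smul_eq_C_mul, map_smul, smul_eq_mul]

theorem hasDerivAt_functional_const (p : ℝ[X]) (s : ℝ) :
    HasDerivAt (fun t => functional t p) (p.eval s * Real.exp (-s ^ 2)) s := by
  have hint := integrable_eval_mul_gaussian p
  have hcont : Continuous fun x : ℝ => p.eval x * Real.exp (-x ^ 2) := by fun_prop
  have h := (intervalIntegral.integral_hasDerivAt_right (hint.intervalIntegrable (a := 0) (b := s))
    hcont.stronglyMeasurable.stronglyMeasurableAtFilter hcont.continuousAt).add_const
    (functional 0 p)
  refine h.congr_of_eventuallyEq (Eventually.of_forall fun t => ?_)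
  simp only [functional_apply]
  rw [← intervalIntegral.integral_Iic_sub_Iic hint.integrableOn hint.integrableOn]
  ring

theorem eval_mul_gaussian_eq_functional (s : ℝ) (q : ℝ[X]) :
    q.eval s * Real.exp (-s ^ 2) = functional s (derivative q - C 2 * (X * q)) := by
  have hderiv (x : ℝ) : HasDerivAt (fun y : ℝ => q.eval y * Real.exp (-y ^ 2))
      ((derivative q - C 2 * (X * q)).eval x * Real.exp (-x ^ 2)) x := by
    have h := (q.hasDerivAt x).mul ((hasDerivAt_pow 2 x).neg.exp)
    refine h.congr_deriv ?_
    simp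
    ring
  have hlim := tendsto_zero_of_hasDerivAt_of_integrableOn_Iic (a := s) (fun x _ => hderiv x)
    (integrable_eval_mul_gaussian _).integrableOn (integrable_eval_mul_gaussian q).integrableOn
  rw [functional_apply, integral_Iic_of_hasDerivAt_of_tendsto' (fun x _ => hderiv x)
    (integrable_eval_mul_gaussian _).integrableOn hlim, sub_zero]

theorem functional_mul_self_pos (s : ℝ) {p : ℝ[X]} (hp : p ≠ 0) : 0 < functional s (p * p) := by
  rw [functional_apply, setIntegral_pos_iff_support_of_nonneg_ae
    (Eventually.of_forall fun x => by
      rw [eval_mul]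
      exact mul_nonneg (mul_self_nonneg (p.eval x)) (Real.exp_nonneg _))
    (integrable_eval_mul_gaussian _).integrableOn]
  have hsub : Iic s \ {x | p.IsRoot x} ⊆
      Function.support (fun x : ℝ => (p * p).eval x * Real.exp (-x ^ 2)) ∩ Iic s := by
    rintro x ⟨hx, hroot⟩
    exact ⟨by simpa using hroot, hx⟩
  refine lt_of_lt_of_le ?_ (measure_mono hsub)
  rw [measure_sdiff_null ((Polynomial.finite_setOfPred_isRoot hp).measure_zero _)]
  simp

/-- Coefficientwise differentiability of a one-parameter family of polynomials. -/
def HasCoeffDerivAt (F : ℝ → ℝ[X]) (F' : ℝ[X]) (s : ℝ) : Prop :=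
  ∀ k, HasDerivAt (fun t => (F t).coeff k) (F'.coeff k) s

theorem HasCoeffDerivAt.const (p : ℝ[X]) (s : ℝ) : HasCoeffDerivAt (fun _ => p) 0 s := fun k => by
  simpa using hasDerivAt_const s (p.coeff k)

theorem HasCoeffDerivAt.mul {F G : ℝ → ℝ[X]} {F' G' : ℝ[X]} {s : ℝ}
    (hF : HasCoeffDerivAt F F' s) (hG : HasCoeffDerivAt G G' s) :
    HasCoeffDerivAt (fun t => F t * G t) (F' * G s + F s * G') s := fun k => by
  simp only [coeff_mul, coeff_add, ← Finset.sum_add_distrib]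
  exact HasDerivAt.fun_sum fun i _ => (hF i.1).mul (hG i.2)

theorem exists_hasCoeffDerivAt {F : ℝ → ℝ[X]} {M : ℕ} (hM : ∀ t, (F t).natDegree ≤ M) {s : ℝ}
    (hF : ∀ k, DifferentiableAt ℝ (fun t => (F t).coeff k) s) :
    ∃ F', HasCoeffDerivAt F F' s := by
  refine ⟨∑ k ∈ Finset.range (M + 1), monomial k (deriv (fun t => (F t).coeff k) s), fun k => ?_⟩
  refine (hF k).hasDerivAt.congr_deriv ?_
  simp only [finsetSum_coeff, coeff_monomial, Finset.sum_ite_eq', Finset.mem_range]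
  split_ifs with hk
  · rfl
  · have : (fun t => (F t).coeff k) = fun _ => 0 :=
      funext fun t => coeff_eq_zero_of_natDegree_lt ((hM t).trans_lt (by omega))
    simp [this]

theorem functional_eq_sum (s : ℝ) (p : ℝ[X]) {M : ℕ} (hM : p.natDegree ≤ M) :
    functional s p = ∑ k ∈ Finset.range (M + 1), p.coeff k * functional s (X ^ k) := by
  conv_lhs => rw [p.as_sum_range_C_mul_X_pow' (Nat.lt_succ_of_le hM)]
  simp [functional_C_mul]

theorem hasDerivAt_functional {F : ℝ → ℝ[X]} {F' : ℝ[X]} {M : ℕ} {s : ℝ}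
    (hM : ∀ t, (F t).natDegree ≤ M) (hF : HasCoeffDerivAt F F' s) :
    HasDerivAt (fun t => functional t (F t))
      ((F s).eval s * Real.exp (-s ^ 2) + functional s F') s := by
  have hM' : F'.natDegree ≤ M := by
    refine natDegree_le_iff_coeff_eq_zero.2 fun k hk => (hF k).unique ?_
    have : (fun t => (F t).coeff k) = fun _ => 0 :=
      funext fun t => coeff_eq_zero_of_natDegree_lt ((hM t).trans_lt hk)
    simpa [this] using hasDerivAt_const s (0 : ℝ)
  have h := HasDerivAt.fun_sum (u := Finset.range (M + 1)) fun k _ =>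
    (hF k).mul (hasDerivAt_functional_const (X ^ k) s)
  rw [funext fun t => functional_eq_sum t (F t) (hM t)]
  refine h.congr_deriv ?_
  rw [functional_eq_sum s F' hM', eval_eq_sum_range' (Nat.lt_succ_of_le (hM s)), Finset.sum_mul,
    ← Finset.sum_add_distrib]
  refine Finset.sum_congr rfl fun k _ => ?_
  simp
  ring

/-- Monic orthogonal polynomials for `functional s`, by the Gram–Schmidt process. -/
def orthoPoly (n : ℕ) (s : ℝ) : ℝ[X] :=
  X ^ n - ∑ j : Fin n, C (functional s (X ^ n * orthoPoly j s) /
    functional s (orthoPoly j s * orthoPoly j s)) * orthoPoly j s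
termination_by n

theorem coeff_orthoPoly_of_le {n k : ℕ} (hk : n ≤ k) (s : ℝ) :
    (orthoPoly n s).coeff k = (X ^ n : ℝ[X]).coeff k := by
  induction n using Nat.strong_induction_on with
  | _ n ih =>
    rw [orthoPoly, coeff_sub, finsetSum_coeff, Finset.sum_eq_zero, sub_zero]
    intro j _
    have hj := j.2
    rw [coeff_C_mul, ih j hj (by omega), coeff_X_pow, if_neg (by omega), mul_zero]

theorem coeff_orthoPoly_self (n : ℕ) (s : ℝ) : (orthoPoly n s).coeff n = 1 := by
  simp [coeff_orthoPoly_of_le le_rfl]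

theorem coeff_orthoPoly_of_lt {n k : ℕ} (hk : n < k) (s : ℝ) : (orthoPoly n s).coeff k = 0 := by
  rw [coeff_orthoPoly_of_le hk.le, coeff_X_pow, if_neg hk.ne']

theorem natDegree_orthoPoly (n : ℕ) (s : ℝ) : (orthoPoly n s).natDegree = n :=
  natDegree_eq_of_le_of_coeff_ne_zero
    (natDegree_le_iff_coeff_eq_zero.2 fun _ hk => coeff_orthoPoly_of_lt hk s)
    (by simp [coeff_orthoPoly_self])

theorem monic_orthoPoly (n : ℕ) (s : ℝ) : (orthoPoly n s).Monic :=
  monic_of_natDegree_le_of_coeff_eq_one n (natDegree_orthoPoly n s).le (coeff_orthoPoly_self n s)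

/-- The squared norm of the orthogonal polynomial of degree `n`. -/
def sqNorm (n : ℕ) (s : ℝ) : ℝ := functional s (orthoPoly n s * orthoPoly n s)

theorem sqNorm_pos (n : ℕ) (s : ℝ) : 0 < sqNorm n s :=
  functional_mul_self_pos s (monic_orthoPoly n s).ne_zero

theorem functional_orthoPoly_mul_of_lt {m n : ℕ} (h : m < n) (s : ℝ) :
    functional s (orthoPoly n s * orthoPoly m s) = 0 := by
  induction n using Nat.strong_induction_on generalizing m with
  | _ n ih =>
    conv_lhs => rw [orthoPoly]
    rw [sub_mul, map_sub, Finset.sum_mul, map_sum, Finset.sum_eq_single ⟨m, h⟩]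
    · rw [mul_assoc, functional_C_mul]
      exact sub_eq_zero.2 (div_mul_cancel₀ _ (sqNorm_pos m s).ne').symm
    · intro j _ hj
      have hjm : (j : ℕ) ≠ m := fun e => hj (Fin.ext e)
      rw [mul_assoc, functional_C_mul]
      rcases lt_or_gt_of_ne hjm with hlt | hlt
      · rw [mul_comm (orthoPoly _ s) (orthoPoly m s), ih m h hlt, mul_zero]
      · rw [ih j j.2 hlt, mul_zero]
    · simp

theorem functional_orthoPoly_mul_of_ne {m n : ℕ} (h : m ≠ n) (s : ℝ) :
    functional s (orthoPoly n s * orthoPoly m s) = 0 := by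
  rcases lt_or_gt_of_ne h with hlt | hlt
  · exact functional_orthoPoly_mul_of_lt hlt s
  · rw [mul_comm, functional_orthoPoly_mul_of_lt hlt s]

theorem degree_sub_coeff_mul_orthoPoly {q : ℝ[X]} {n : ℕ} (hq : q.degree < (n + 1 : ℕ)) (s : ℝ) :
    (q - C (q.coeff n) * orthoPoly n s).degree < n := by
  rw [degree_lt_iff_coeff_zero] at hq ⊢
  intro k hk
  rw [coeff_sub, coeff_C_mul]
  rcases hk.eq_or_lt with rfl | hlt
  · simp [coeff_orthoPoly_self]
  · simp [coeff_orthoPoly_of_lt hlt, hq k hlt]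

theorem functional_orthoPoly_mul_of_degree_lt {q : ℝ[X]} {n : ℕ} (hq : q.degree < n) (s : ℝ) :
    functional s (orthoPoly n s * q) = 0 := by
  suffices ∀ d ≤ n, ∀ r : ℝ[X], r.degree < d → functional s (orthoPoly n s * r) = 0 from
    this n le_rfl q hq
  intro d
  induction d with
  | zero =>
    intro _ r hr
    have : r = 0 := by simpa using hr
    simp [this]
  | succ d ih =>
    intro hd r hr
    have h := ih (by omega) _ (degree_sub_coeff_mul_orthoPoly hr s)
    rwa [mul_sub, map_sub, mul_left_comm, functional_C_mul,
      functional_orthoPoly_mul_of_lt (by omega) s, mul_zero, sub_zero] at h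

theorem functional_orthoPoly_mul {q : ℝ[X]} {n : ℕ} (hq : q.natDegree ≤ n) (s : ℝ) :
    functional s (orthoPoly n s * q) = q.coeff n * sqNorm n s := by
  have hq' : q.degree < (n + 1 : ℕ) :=
    (degree_le_of_natDegree_le hq).trans_lt (by exact_mod_cast n.lt_succ_self)
  have h := functional_orthoPoly_mul_of_degree_lt (degree_sub_coeff_mul_orthoPoly hq' s) s
  rw [mul_sub, map_sub, mul_left_comm, functional_C_mul, sub_eq_zero] at h
  exact h

theorem differentiable_coeff_orthoPoly (n k : ℕ) :
    Differentiable ℝ fun t => (orthoPoly n t).coeff k := by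
  induction n using Nat.strong_induction_on generalizing k with
  | _ n ih =>
    have hpoly (j : Fin n) (s : ℝ) : ∃ P', HasCoeffDerivAt (orthoPoly j) P' s :=
      exists_hasCoeffDerivAt (fun t => (natDegree_orthoPoly j t).le) fun k => ih j j.2 k s
    have hnum (j : Fin n) : Differentiable ℝ fun t => functional t (X ^ n * orthoPoly j t) := by
      intro s
      obtain ⟨P', hP'⟩ := hpoly j s
      refine (hasDerivAt_functional (M := n + j) (fun t => ?_)
        ((HasCoeffDerivAt.const (X ^ n) s).mul hP')).differentiableAt
      exact natDegree_mul_le_of_le (by simp) (natDegree_orthoPoly j t).le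
    have hden (j : Fin n) : Differentiable ℝ fun t =>
        functional t (orthoPoly j t * orthoPoly j t) := by
      intro s
      obtain ⟨P', hP'⟩ := hpoly j s
      refine (hasDerivAt_functional (M := j + j) (fun t => ?_) (hP'.mul hP')).differentiableAt
      exact natDegree_mul_le_of_le (natDegree_orthoPoly j t).le (natDegree_orthoPoly j t).le
    have heq : (fun t => (orthoPoly n t).coeff k) = fun t => (X ^ n : ℝ[X]).coeff k -
        ∑ j : Fin n, functional t (X ^ n * orthoPoly j t) /
          functional t (orthoPoly j t * orthoPoly j t) * (orthoPoly j t).coeff k := by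
      funext t
      rw [orthoPoly]
      simp only [coeff_sub, finsetSum_coeff, coeff_C_mul]
    rw [heq]
    refine (differentiable_const _).sub (Differentiable.fun_sum fun j _ => ?_)
    exact ((hnum j).fun_div (hden j) fun t => (sqNorm_pos j t).ne').mul (ih j j.2 k)

theorem exists_hasCoeffDerivAt_orthoPoly (n : ℕ) (s : ℝ) :
    ∃ P', HasCoeffDerivAt (orthoPoly n) P' s ∧ P'.degree < n := by
  obtain ⟨P', hP'⟩ := exists_hasCoeffDerivAt (fun t => (natDegree_orthoPoly n t).le)
    fun k => differentiable_coeff_orthoPoly n k s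
  refine ⟨P', hP', (degree_lt_iff_coeff_zero _ _).2 fun k hk => (hP' k).unique ?_⟩
  rcases hk.eq_or_lt with rfl | hlt
  · simpa [coeff_orthoPoly_self] using hasDerivAt_const s (1 : ℝ)
  · simpa [coeff_orthoPoly_of_lt hlt] using hasDerivAt_const s (0 : ℝ)

theorem hasDerivAt_sqNorm (n : ℕ) (s : ℝ) :
    HasDerivAt (sqNorm n) ((orthoPoly n s).eval s ^ 2 * Real.exp (-s ^ 2)) s := by
  obtain ⟨P', hP', hdeg⟩ := exists_hasCoeffDerivAt_orthoPoly n s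
  have h := hasDerivAt_functional (M := n + n) (fun t => natDegree_mul_le_of_le
    (natDegree_orthoPoly n t).le (natDegree_orthoPoly n t).le) (hP'.mul hP')
  refine h.congr_deriv ?_
  rw [map_add, mul_comm P', functional_orthoPoly_mul_of_degree_lt hdeg, eval_mul]
  ring

theorem hasDerivAt_coeff_orthoPoly_succ (n : ℕ) (s : ℝ) :
    HasDerivAt (fun t => (orthoPoly (n + 1) t).coeff n)
      (-((orthoPoly (n + 1) s).eval s * (orthoPoly n s).eval s * Real.exp (-s ^ 2) /
        sqNorm n s)) s := by
  obtain ⟨P', hP', hdegP⟩ := exists_hasCoeffDerivAt_orthoPoly (n + 1) s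
  obtain ⟨Q', hQ', hdegQ⟩ := exists_hasCoeffDerivAt_orthoPoly n s
  have h := hasDerivAt_functional (M := n + 1 + n) (fun t => natDegree_mul_le_of_le
    (natDegree_orthoPoly (n + 1) t).le (natDegree_orthoPoly n t).le) (hP'.mul hQ')
  have hzero : (fun t => functional t (orthoPoly (n + 1) t * orthoPoly n t)) = fun _ => 0 :=
    funext fun t => functional_orthoPoly_mul_of_lt n.lt_succ_self t
  rw [hzero] at h
  have h0 := h.unique (hasDerivAt_const s (0 : ℝ))
  have hdegP' : P'.natDegree ≤ n := natDegree_le_iff_coeff_eq_zero.2 fun k hk =>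
    (degree_lt_iff_coeff_zero _ _).1 hdegP k hk
  rw [map_add, mul_comm P', functional_orthoPoly_mul hdegP',
    functional_orthoPoly_mul_of_degree_lt (hdegQ.trans (by exact_mod_cast n.lt_succ_self)),
    eval_mul] at h0
  refine (hP' n).congr_deriv ?_
  have := (sqNorm_pos n s).ne'
  field_simp
  linarith

theorem degree_derivative_orthoPoly_lt (n : ℕ) (s : ℝ) :
    (derivative (orthoPoly n s)).degree < n := by
  simpa [degree_eq_natDegree (monic_orthoPoly n s).ne_zero, natDegree_orthoPoly] using
    degree_derivative_lt (monic_orthoPoly n s).ne_zero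

theorem natDegree_X_mul_orthoPoly_sub_le (n : ℕ) (s : ℝ) :
    (X * orthoPoly n s - orthoPoly (n + 1) s).natDegree ≤ n := by
  refine natDegree_le_iff_coeff_eq_zero.2 fun k hk => ?_
  obtain ⟨k, rfl⟩ : ∃ j, k = j + 1 := ⟨k - 1, by omega⟩
  rw [coeff_sub, coeff_X_mul, coeff_orthoPoly_of_le (by omega), coeff_orthoPoly_of_le (by omega)]
  simp [coeff_X_pow]

/-- The coefficient of `x ^ (n - 1)` in the orthogonal polynomial of degree `n`, being `0` for
`n = 0`. -/
def subleadingCoeff (n : ℕ) (s : ℝ) : ℝ := (X * orthoPoly n s).coeff n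

theorem subleadingCoeff_succ (n : ℕ) (s : ℝ) :
    subleadingCoeff (n + 1) s = (orthoPoly (n + 1) s).coeff n := coeff_X_mul _ _

theorem functional_X_mul_orthoPoly (n : ℕ) (s : ℝ) :
    functional s (orthoPoly n s * (X * orthoPoly n s)) =
      (subleadingCoeff n s - subleadingCoeff (n + 1) s) * sqNorm n s := by
  have h := functional_orthoPoly_mul (natDegree_X_mul_orthoPoly_sub_le n s) s
  rw [mul_sub, map_sub, functional_orthoPoly_mul_of_ne (by omega), sub_zero, coeff_sub] at h
  rw [h, subleadingCoeff_succ, subleadingCoeff]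

theorem functional_X_sq_mul_orthoPoly (n : ℕ) (s : ℝ) :
    functional s (orthoPoly (n + 1) s * (X * (X * orthoPoly n s))) =
      (subleadingCoeff n s - subleadingCoeff (n + 2) s) * sqNorm (n + 1) s := by
  have hdeg := natDegree_X_mul_orthoPoly_sub_le n s
  have h := functional_orthoPoly_mul (n := n + 1)
    (q := X * (X * orthoPoly n s - orthoPoly (n + 1) s))
    (by simpa [add_comm] using natDegree_mul_le_of_le natDegree_X_le hdeg) s
  rw [coeff_X_mul, coeff_sub, mul_sub, mul_sub, map_sub, functional_X_mul_orthoPoly,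
    ← subleadingCoeff_succ] at h
  rw [subleadingCoeff]
  linarith

theorem eval_sq_orthoPoly (n : ℕ) (s : ℝ) :
    (orthoPoly n s).eval s ^ 2 * Real.exp (-s ^ 2) =
      2 * (subleadingCoeff (n + 1) s - subleadingCoeff n s) * sqNorm n s := by
  have h := eval_mul_gaussian_eq_functional s (orthoPoly n s * orthoPoly n s)
  have hd := functional_orthoPoly_mul_of_degree_lt (degree_derivative_orthoPoly_lt n s) s
  rw [map_sub, functional_C_mul, mul_left_comm X, functional_X_mul_orthoPoly, derivative_mul,
    map_add, mul_comm (derivative _), hd, eval_mul] at h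
  linarith

theorem functional_X_mul_orthoPoly_succ (n : ℕ) (s : ℝ) :
    functional s (orthoPoly (n + 1) s * (X * orthoPoly n s)) = sqNorm (n + 1) s := by
  rw [functional_orthoPoly_mul (n := n + 1), coeff_X_mul, coeff_orthoPoly_self, one_mul]
  simpa [add_comm] using natDegree_mul_le_of_le natDegree_X_le (natDegree_orthoPoly n s).le

theorem functional_derivative_orthoPoly (n : ℕ) (s : ℝ) :
    functional s (orthoPoly n s * derivative (orthoPoly (n + 1) s)) = (n + 1) * sqNorm n s := by
  rw [functional_orthoPoly_mul, coeff_derivative, coeff_orthoPoly_self, one_mul]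
  exact (natDegree_derivative_le _).trans (by simp [natDegree_orthoPoly])

theorem eval_mul_eval_orthoPoly (n : ℕ) (s : ℝ) :
    (orthoPoly (n + 1) s).eval s * (orthoPoly n s).eval s * Real.exp (-s ^ 2) =
      (n + 1) * sqNorm n s - 2 * sqNorm (n + 1) s := by
  have h := eval_mul_gaussian_eq_functional s (orthoPoly (n + 1) s * orthoPoly n s)
  have hd := functional_orthoPoly_mul_of_degree_lt
    ((degree_derivative_orthoPoly_lt n s).trans (by exact_mod_cast n.lt_succ_self)) s (n := n + 1)
  rw [map_sub, functional_C_mul, mul_left_comm X, functional_X_mul_orthoPoly_succ, derivative_mul,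
    map_add, mul_comm (derivative _), functional_derivative_orthoPoly, hd, eval_mul] at h
  linarith

theorem functional_X_mul_derivative_orthoPoly (n : ℕ) (s : ℝ) :
    functional s (orthoPoly n s * (X * derivative (orthoPoly (n + 1) s))) =
      -subleadingCoeff (n + 1) s * sqNorm n s := by
  have hdeg : (X * derivative (orthoPoly (n + 1) s) -
      C (n + 1 : ℝ) * orthoPoly (n + 1) s).natDegree ≤ n := by
    refine natDegree_le_iff_coeff_eq_zero.2 fun k hk => ?_
    obtain ⟨k, rfl⟩ : ∃ j, k = j + 1 := ⟨k - 1, by omega⟩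
    rw [coeff_sub, coeff_X_mul, coeff_derivative, coeff_C_mul, coeff_orthoPoly_of_le (by omega),
      coeff_X_pow]
    split_ifs with h
    · rw [Nat.add_right_cancel h]; ring
    · ring
  have h := functional_orthoPoly_mul hdeg s
  rw [mul_sub, map_sub, mul_left_comm _ (C _), functional_C_mul,
    functional_orthoPoly_mul_of_ne (by omega), coeff_sub, coeff_C_mul,
    ← subleadingCoeff_succ] at h
  have hc : (X * derivative (orthoPoly (n + 1) s)).coeff n = n * subleadingCoeff (n + 1) s := by
    rw [subleadingCoeff_succ]
    cases n with
    | zero => simp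
    | succ n => rw [coeff_X_mul, coeff_derivative]; push_cast; ring
  rw [hc] at h
  linarith

/-- The identity obtained by integrating the derivative of `(x - s) P_{n+1} P_n e^{-x²}`. -/
theorem subleadingCoeff_add_eq (n : ℕ) (s : ℝ) :
    (subleadingCoeff (n + 1) s + s * (n + 1)) * sqNorm n s =
      2 * (subleadingCoeff (n + 2) s - subleadingCoeff n s + s) * sqNorm (n + 1) s := by
  have h := eval_mul_gaussian_eq_functional s ((X - C s) * (orthoPoly (n + 1) s * orthoPoly n s))
  have hd := degree_derivative_orthoPoly_lt n s
  have h1 := functional_orthoPoly_mul_of_degree_lt (n := n + 1)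
    (hd.trans (by exact_mod_cast n.lt_succ_self)) s
  have h2 : functional s (orthoPoly (n + 1) s * (X * derivative (orthoPoly n s))) = 0 := by
    refine functional_orthoPoly_mul_of_degree_lt ?_ s
    rw [degree_lt_iff_coeff_zero] at hd ⊢
    intro k hk
    obtain ⟨k, rfl⟩ : ∃ j, k = j + 1 := ⟨k - 1, by omega⟩
    rw [coeff_X_mul, hd k (by omega)]
  have hexp : derivative ((X - C s) * (orthoPoly (n + 1) s * orthoPoly n s)) -
      C 2 * (X * ((X - C s) * (orthoPoly (n + 1) s * orthoPoly n s))) =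
      orthoPoly (n + 1) s * orthoPoly n s +
      orthoPoly n s * (X * derivative (orthoPoly (n + 1) s)) -
      C s * (orthoPoly n s * derivative (orthoPoly (n + 1) s)) +
      orthoPoly (n + 1) s * (X * derivative (orthoPoly n s)) -
      C s * (orthoPoly (n + 1) s * derivative (orthoPoly n s)) -
      C 2 * (orthoPoly (n + 1) s * (X * (X * orthoPoly n s))) +
      C 2 * (C s * (orthoPoly (n + 1) s * (X * orthoPoly n s))) := by
    simp only [derivative_mul, derivative_sub, derivative_X, derivative_C]
    ring
  rw [hexp] at h
  simp only [map_add, map_sub, functional_C_mul, functional_X_mul_orthoPoly_succ,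
    functional_X_sq_mul_orthoPoly, functional_X_mul_derivative_orthoPoly,
    functional_derivative_orthoPoly, h1, h2, functional_orthoPoly_mul_of_lt n.lt_succ_self] at h
  simp at h
  linarith

/-- Andréief's identity for the truncated Gaussian weight. -/
theorem setIntegral_vandermonde_sq (N : ℕ) (s : ℝ) :
    (∫ x in univ.pi fun _ : Fin N => Iic s,
      (∏ j, Real.exp (-(x j) ^ 2)) * ∏ j, ∏ k ∈ Finset.Ioi j, (x k - x j) ^ 2) =
      N.factorial * ∏ j ∈ Finset.range N, sqNorm j s := by
  have hprod (σ τ : Equiv.Perm (Fin N)) (x : Fin N → ℝ) :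
      (∏ j, Real.exp (-(x j) ^ 2)) * ((∏ j, (orthoPoly (σ j) s).eval (x j)) *
        ∏ j, (orthoPoly (τ j) s).eval (x j)) =
      ∏ j, (orthoPoly (σ j) s * orthoPoly (τ j) s).eval (x j) * Real.exp (-(x j) ^ 2) := by
    simp only [← Finset.prod_mul_distrib, eval_mul]
    exact Finset.prod_congr rfl fun j _ => mul_comm _ _
  have hexp (x : Fin N → ℝ) :
      (∏ j, Real.exp (-(x j) ^ 2)) * ∏ j, ∏ k ∈ Finset.Ioi j, (x k - x j) ^ 2 =
      ∑ σ : Equiv.Perm (Fin N), ∑ τ : Equiv.Perm (Fin N),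
        ((Equiv.Perm.sign σ : ℤ) * (Equiv.Perm.sign τ : ℤ) : ℝ) *
        ∏ j, (orthoPoly (σ j) s * orthoPoly (τ j) s).eval (x j) * Real.exp (-(x j) ^ 2) := by
    simp only [Finset.prod_pow]
    rw [← Matrix.det_vandermonde, Matrix.det_eval_matrixOfPolynomials_eq_det_vandermonde x
      (fun i => orthoPoly i s) (fun i => natDegree_orthoPoly i s) (fun i => monic_orthoPoly i s),
      ← Matrix.det_transpose, Matrix.det_apply', sq, Finset.sum_mul_sum, Finset.mul_sum]
    refine Finset.sum_congr rfl fun σ _ => ?_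
    rw [Finset.mul_sum]
    refine Finset.sum_congr rfl fun τ _ => ?_
    rw [← hprod]
    simp only [Matrix.transpose_apply, Matrix.of_apply]
    ring
  have hint (σ τ : Equiv.Perm (Fin N)) : Integrable
      (fun x : Fin N → ℝ => ((Equiv.Perm.sign σ : ℤ) * (Equiv.Perm.sign τ : ℤ) : ℝ) *
        ∏ j, (orthoPoly (σ j) s * orthoPoly (τ j) s).eval (x j) * Real.exp (-(x j) ^ 2))
      (Measure.pi fun _ => volume.restrict (Iic s)) :=
    (Integrable.fintype_prod fun j => (integrable_eval_mul_gaussian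
      (orthoPoly (σ j) s * orthoPoly (τ j) s)).integrableOn).const_mul _
  have hval (σ τ : Equiv.Perm (Fin N)) :
      (∫ x : Fin N → ℝ, ((Equiv.Perm.sign σ : ℤ) * (Equiv.Perm.sign τ : ℤ) : ℝ) *
        ∏ j, (orthoPoly (σ j) s * orthoPoly (τ j) s).eval (x j) * Real.exp (-(x j) ^ 2)
        ∂(Measure.pi fun _ => volume.restrict (Iic s))) =
      if σ = τ then ∏ j ∈ Finset.range N, sqNorm j s else 0 := by
    rw [integral_const_mul, integral_fintype_prod_eq_prod
      (f := fun j x => (orthoPoly (σ j) s * orthoPoly (τ j) s).eval x * Real.exp (-x ^ 2))]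
    simp only [← functional_apply]
    split_ifs with h
    · subst h
      rw [← Int.cast_mul, Int.units_coe_mul_self, Int.cast_one, one_mul,
        Equiv.prod_comp σ fun j : Fin N => functional s (orthoPoly j s * orthoPoly j s)]
      exact Fin.prod_univ_eq_prod_range (fun j => sqNorm j s) N
    · obtain ⟨j, hj⟩ : ∃ j, σ j ≠ τ j := by
        by_contra! hcon
        exact h (Equiv.ext hcon)
      rw [Finset.prod_eq_zero (Finset.mem_univ j), mul_zero]
      exact functional_orthoPoly_mul_of_ne (fun e => hj (Fin.ext e).symm) s
  simp only [hexp]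
  rw [volume_pi, Measure.restrict_pi_pi,
    integral_finsetSum _ fun σ _ => integrable_finsetSum _ fun τ _ => hint σ τ]
  simp only [integral_finsetSum _ fun τ _ => hint _ τ, hval, Finset.sum_ite_eq, Finset.mem_univ,
    if_true, Finset.sum_const, Finset.card_univ, Fintype.card_perm, Fintype.card_fin,
    nsmul_eq_mul]

theorem hasDerivAt_prod_sqNorm (N : ℕ) (s : ℝ) :
    HasDerivAt (fun t => ∏ j ∈ Finset.range N, sqNorm j t)
      (2 * subleadingCoeff N s * ∏ j ∈ Finset.range N, sqNorm j s) s := by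
  induction N with
  | zero => simpa [subleadingCoeff] using hasDerivAt_const s (1 : ℝ)
  | succ N ih =>
    simp only [Finset.prod_range_succ]
    refine (ih.mul (hasDerivAt_sqNorm N s)).congr_deriv ?_
    rw [eval_sq_orthoPoly]
    ring

theorem hasDerivAt_subleadingCoeff_succ (n : ℕ) (s : ℝ) :
    HasDerivAt (subleadingCoeff (n + 1)) (2 * (sqNorm (n + 1) s / sqNorm n s) - (n + 1)) s := by
  rw [funext (subleadingCoeff_succ n)]
  refine (hasDerivAt_coeff_orthoPoly_succ n s).congr_deriv ?_
  rw [eval_mul_eval_orthoPoly]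
  have := (sqNorm_pos n s).ne'
  field_simp
  ring

theorem hasDerivAt_sqNorm_ratio (n : ℕ) (s : ℝ) :
    HasDerivAt (fun t => sqNorm (n + 1) t / sqNorm n t)
      (2 * (sqNorm (n + 1) s / sqNorm n s) *
        (subleadingCoeff (n + 2) s - 2 * subleadingCoeff (n + 1) s + subleadingCoeff n s)) s := by
  have := (sqNorm_pos n s).ne'
  refine ((hasDerivAt_sqNorm (n + 1) s).fun_div (hasDerivAt_sqNorm n s) this).congr_deriv ?_
  rw [eval_sq_orthoPoly, eval_sq_orthoPoly]
  field_simp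
  ring

theorem sigma_identity (n : ℕ) (s : ℝ) :
    let p := subleadingCoeff (n + 1) s
    let b := sqNorm (n + 1) s / sqNorm n s
    (8 * b * (subleadingCoeff (n + 2) s - 2 * p + subleadingCoeff n s)) ^ 2 +
      4 * (2 * (2 * b - (n + 1))) ^ 2 * (2 * (2 * b - (n + 1)) + 2 * (n + 1)) -
      4 * (s * (2 * (2 * b - (n + 1))) - 2 * p) ^ 2 = 0 := by
  intro p b
  have hn := (sqNorm_pos n s).ne'
  have hb : sqNorm (n + 1) s = b * sqNorm n s := (div_mul_cancel₀ _ hn).symm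
  have hlin : p + s * (n + 1) = 2 * (subleadingCoeff (n + 2) s - subleadingCoeff n s + s) * b := by
    have h := subleadingCoeff_add_eq n s
    rw [hb] at h
    exact mul_right_cancel₀ hn (by linarith)
  have hquad : (n + 1 - 2 * b) ^ 2 =
      4 * (subleadingCoeff (n + 2) s - p) * (p - subleadingCoeff n s) * b := by
    have h := eval_mul_eval_orthoPoly n s
    have h0 := eval_sq_orthoPoly n s
    have h1 := eval_sq_orthoPoly (n + 1) s
    have hsq : ((n + 1) * sqNorm n s - 2 * sqNorm (n + 1) s) ^ 2 =
        (2 * (subleadingCoeff (n + 2) s - p) * sqNorm (n + 1) s) *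
        (2 * (p - subleadingCoeff n s) * sqNorm n s) := by
      rw [← h, ← h0, ← h1]
      ring
    rw [hb] at hsq
    refine mul_right_cancel₀ (pow_ne_zero 2 hn) ?_
    linear_combination hsq
  have hres : s * (2 * (2 * b - (n + 1))) - 2 * p =
      -(4 * b * (subleadingCoeff (n + 2) s - subleadingCoeff n s)) := by
    linear_combination -2 * hlin
  rw [hres]
  linear_combination 64 * b * hquad

end TruncatedGaussian

end

open TruncatedGaussian in
/-- The logarithmic derivative `R_N = G_N'/G_N` of the GUE gap-probability integral
`G_N(s) = ∫_{(-∞,s]^N} ∏ e^{-x_j²} ∏_{j<k}(x_k-x_j)² dx` satisfies the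
Jimbo–Miwa–Okamoto σ-form of PIV:
`(R_N'')² + 4(R_N')²(R_N' + 2N) - 4(sR_N' - R_N)² = 0`. -/
theorem gap_probability_sigma_PIV (N : ℕ) (hN : 0 < N) (G R : ℝ → ℝ)
    (hG : ∀ s, G s = ∫ x in Set.univ.pi fun _ : Fin N => Set.Iic s,
        (∏ j, Real.exp (-(x j) ^ 2)) * ∏ j, ∏ k ∈ Finset.Ioi j, (x k - x j) ^ 2)
    (hR : ∀ s, R s = deriv G s / G s) :
    (∀ s, 0 < G s) ∧ Differentiable ℝ R ∧ Differentiable ℝ (deriv R) ∧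
    ∀ s, (deriv (deriv R) s) ^ 2 + 4 * (deriv R s) ^ 2 * (deriv R s + 2 * N)
        - 4 * (s * deriv R s - R s) ^ 2 = 0 := by
  obtain ⟨n, rfl⟩ : ∃ n, N = n + 1 := ⟨N - 1, by omega⟩
  have hG' : G = fun s => ((n + 1).factorial : ℝ) * ∏ j ∈ Finset.range (n + 1), sqNorm j s :=
    funext fun s => (hG s).trans (setIntegral_vandermonde_sq (n + 1) s)
  have hpos (s : ℝ) : 0 < G s := by
    rw [hG']
    exact mul_pos (by positivity) (Finset.prod_pos fun j _ => sqNorm_pos j s)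
  have hR' : R = fun s => 2 * subleadingCoeff (n + 1) s := by
    funext s
    have hd : HasDerivAt G (2 * subleadingCoeff (n + 1) s * G s) s := by
      rw [hG']
      exact ((hasDerivAt_prod_sqNorm (n + 1) s).const_mul _).congr_deriv (by ring)
    rw [hR, hd.deriv, mul_div_cancel_right₀ _ (hpos s).ne']
  have hR1 (s : ℝ) : HasDerivAt R (2 * (2 * (sqNorm (n + 1) s / sqNorm n s) - (n + 1))) s := by
    rw [hR']
    exact (hasDerivAt_subleadingCoeff_succ n s).const_mul 2
  have hR2 (s : ℝ) : HasDerivAt (deriv R) (8 * (sqNorm (n + 1) s / sqNorm n s) *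
      (subleadingCoeff (n + 2) s - 2 * subleadingCoeff (n + 1) s + subleadingCoeff n s)) s := by
    rw [funext fun t => (hR1 t).deriv]
    exact ((((hasDerivAt_sqNorm_ratio n s).const_mul 2).sub_const _).const_mul 2).congr_deriv
      (by ring)
  refine ⟨hpos, fun s => (hR1 s).differentiableAt, fun s => (hR2 s).differentiableAt, fun s => ?_⟩
  rw [(hR2 s).deriv, (hR1 s).deriv, hR']
  exact_mod_cast sigma_identity n s
end

section
/- For a positive integer N and a real number a ≥ 0, define D_N(s;a) := ∫_{(−∞,s]^N} ∏_{j=1}^N e^{−x_j²}(s − x_j)^a ∏_{1≤j<k≤N}(x_k − x_j)² dx₁⋯dx_N (so D_N(s;a) > 0 for all s), and define U_N(s;a) := (d/ds) log D_N(s;a). Then U_N(·;a) is twice differentiable and satisfies the Jimbo–Miwa–Okamoto σ-form of the Painlevé IV equation (U_N''(s))² − 4(s·U_N'(s) − U_N(s))² + 4U_N'(s)(U_N'(s) − 2a)(U_N'(s) + 2N) = 0 for all real s. -/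
open MeasureTheory

section OrthogonalPolynomials

open Polynomial

/-- The monic orthogonal polynomials of a linear functional on `ℝ[X]`, defined by their
three-term recurrence. -/
noncomputable def orthoPoly (L : ℝ[X] →ₗ[ℝ] ℝ) : ℕ → ℝ[X]
  | 0 => 1
  | 1 => X - C (L X / L 1)
  | n + 2 => (X - C (L (X * (orthoPoly L (n + 1) * orthoPoly L (n + 1)))
        / L (orthoPoly L (n + 1) * orthoPoly L (n + 1)))) * orthoPoly L (n + 1)
      - C (L (orthoPoly L (n + 1) * orthoPoly L (n + 1)) / L (orthoPoly L n * orthoPoly L n))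
        * orthoPoly L n

/-- The squared norm `L (pₙ²)` of the `n`-th orthogonal polynomial. -/
noncomputable def orthoNorm (L : ℝ[X] →ₗ[ℝ] ℝ) (n : ℕ) : ℝ :=
  L (orthoPoly L n * orthoPoly L n)

/-- The diagonal coefficient of the three-term recurrence. -/
noncomputable def orthoDiag (L : ℝ[X] →ₗ[ℝ] ℝ) (n : ℕ) : ℝ :=
  L (X * (orthoPoly L n * orthoPoly L n)) / orthoNorm L n

/-- The off-diagonal coefficient of the three-term recurrence. -/
noncomputable def orthoOff (L : ℝ[X] →ₗ[ℝ] ℝ) : ℕ → ℝ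
  | 0 => 0
  | n + 1 => orthoNorm L (n + 1) / orthoNorm L n

theorem orthoPoly_succ (L : ℝ[X] →ₗ[ℝ] ℝ) (n : ℕ) :
    orthoPoly L (n + 1) = (X - C (orthoDiag L n)) * orthoPoly L n
      - C (orthoOff L n) * orthoPoly L (n - 1) := by
  cases n with
  | zero => simp [orthoPoly, orthoDiag, orthoOff, orthoNorm]
  | succ n => rw [orthoPoly]; rfl

theorem X_mul_orthoPoly (L : ℝ[X] →ₗ[ℝ] ℝ) (n : ℕ) :
    X * orthoPoly L n = orthoPoly L (n + 1) + C (orthoDiag L n) * orthoPoly L n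
      + C (orthoOff L n) * orthoPoly L (n - 1) := by
  rw [orthoPoly_succ]; ring

theorem map_C_mul (L : ℝ[X] →ₗ[ℝ] ℝ) (c : ℝ) (p : ℝ[X]) : L (C c * p) = c * L p := by
  rw [← smul_eq_C_mul, map_smul, smul_eq_mul]

theorem natDegree_orthoPoly_le (L : ℝ[X] →ₗ[ℝ] ℝ) (n : ℕ) :
    (orthoPoly L n).natDegree ≤ n := by
  induction n using Nat.strong_induction_on with
  | _ n ih =>
    cases n with
    | zero => simp [orthoPoly]
    | succ n =>
      rw [orthoPoly_succ]
      refine (natDegree_sub_le _ _).trans (max_le ?_ ?_)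
      · refine natDegree_mul_le.trans ?_
        have := ih n (by omega)
        rw [natDegree_X_sub_C]; omega
      · refine (natDegree_C_mul_le _ _).trans ?_
        have := ih (n - 1) (by omega)
        omega

theorem coeff_orthoPoly_self (L : ℝ[X] →ₗ[ℝ] ℝ) (n : ℕ) : (orthoPoly L n).coeff n = 1 := by
  induction n with
  | zero => simp [orthoPoly]
  | succ n ih =>
    have h1 : (orthoPoly L n).coeff (n + 1) = 0 :=
      coeff_eq_zero_of_natDegree_lt (by have := natDegree_orthoPoly_le L n; omega)
    have h2 : (orthoPoly L (n - 1)).coeff (n + 1) = 0 :=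
      coeff_eq_zero_of_natDegree_lt (by have := natDegree_orthoPoly_le L (n - 1); omega)
    rw [orthoPoly_succ, sub_mul, coeff_sub, coeff_sub, coeff_X_mul, coeff_C_mul, coeff_C_mul,
      ih, h1, h2]
    ring

theorem coeff_orthoPoly_succ (L : ℝ[X] →ₗ[ℝ] ℝ) (n : ℕ) :
    (orthoPoly L (n + 1)).coeff n = -∑ j ∈ Finset.range (n + 1), orthoDiag L j := by
  induction n with
  | zero => simp [orthoPoly, orthoDiag, orthoNorm]
  | succ n ih =>
    have h2 : (orthoPoly L n).coeff (n + 1) = 0 :=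
      coeff_eq_zero_of_natDegree_lt (by have := natDegree_orthoPoly_le L n; omega)
    rw [orthoPoly_succ, sub_mul, coeff_sub, coeff_sub, coeff_X_mul, coeff_C_mul, coeff_C_mul,
      ih, Nat.add_sub_cancel, h2, coeff_orthoPoly_self, Finset.sum_range_succ _ (n + 1)]
    ring

theorem natDegree_orthoPoly (L : ℝ[X] →ₗ[ℝ] ℝ) (n : ℕ) : (orthoPoly L n).natDegree = n :=
  natDegree_eq_of_le_of_coeff_ne_zero (natDegree_orthoPoly_le L n)
    (by rw [coeff_orthoPoly_self]; exact one_ne_zero)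

theorem monic_orthoPoly (L : ℝ[X] →ₗ[ℝ] ℝ) (n : ℕ) : (orthoPoly L n).Monic :=
  monic_of_natDegree_le_of_coeff_eq_one n (natDegree_orthoPoly_le L n) (coeff_orthoPoly_self L n)

/-- Positive definiteness of a functional on polynomials. -/
def PosDefFunctional (L : ℝ[X] →ₗ[ℝ] ℝ) : Prop := ∀ p : ℝ[X], p ≠ 0 → 0 < L (p * p)

variable {L : ℝ[X] →ₗ[ℝ] ℝ}

theorem orthoNorm_pos (hL : PosDefFunctional L) (n : ℕ) : 0 < orthoNorm L n :=
  hL _ (monic_orthoPoly L n).ne_zero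

theorem orthoDiag_mul_orthoNorm (hL : PosDefFunctional L) (n : ℕ) :
    L (X * (orthoPoly L n * orthoPoly L n)) = orthoDiag L n * orthoNorm L n :=
  (div_mul_cancel₀ _ (orthoNorm_pos hL n).ne').symm

theorem orthoOff_mul_orthoNorm (hL : PosDefFunctional L) (n : ℕ) :
    orthoOff L (n + 1) * orthoNorm L n = orthoNorm L (n + 1) :=
  div_mul_cancel₀ _ (ne_of_gt (orthoNorm_pos hL n))

/-- If `q` has degree at most `n + 1`, subtracting its leading multiple of `pₙ₊₁` lowers the
degree bound. -/
theorem natDegree_sub_coeff_mul_orthoPoly_le (L : ℝ[X] →ₗ[ℝ] ℝ) {n : ℕ} {q : ℝ[X]}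
    (hq : q.natDegree ≤ n + 1) :
    (q - C (q.coeff (n + 1)) * orthoPoly L (n + 1)).natDegree ≤ n := by
  rw [natDegree_le_iff_coeff_eq_zero]
  intro k hk
  rw [coeff_sub, coeff_C_mul]
  rcases (Nat.succ_le_of_lt hk).eq_or_lt with h | h
  · rw [← h, Nat.succ_eq_add_one, coeff_orthoPoly_self]; ring
  · rw [coeff_eq_zero_of_natDegree_lt (by omega : q.natDegree < k),
      coeff_eq_zero_of_natDegree_lt
        (lt_of_le_of_lt (natDegree_orthoPoly_le L (n + 1)) h)]
    ring

theorem map_orthoPoly_mul (hL : PosDefFunctional L) (n : ℕ) :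
    ∀ q : ℝ[X], q.natDegree ≤ n → L (orthoPoly L n * q) = q.coeff n * orthoNorm L n := by
  induction n using Nat.strong_induction_on with
  | _ n ih =>
    cases n with
    | zero =>
      intro q hq
      rw [eq_C_of_natDegree_le_zero hq, mul_comm, map_C_mul, coeff_C_zero, orthoNorm]
      simp [orthoPoly]
    | succ n =>
      have key : ∀ r : ℝ[X], r.natDegree ≤ n → L (orthoPoly L (n + 1) * r) = 0 := by
        have hn := ih n (Nat.lt_succ_self n)
        cases n with
        | zero =>
          intro r hr
          rw [eq_C_of_natDegree_le_zero hr, mul_comm, map_C_mul, orthoPoly_succ]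
          have h1 := orthoDiag_mul_orthoNorm hL 0
          simp only [orthoPoly, orthoNorm, mul_one] at h1
          simp only [orthoPoly, orthoOff, mul_one, map_sub, map_zero, h1]
          rw [← mul_one (C (orthoDiag L 0)), map_C_mul, zero_mul, map_zero]
          ring
        | succ n =>
          have hn' := ih n (by omega)
          have hlow : ∀ r : ℝ[X], r.natDegree ≤ n → L (orthoPoly L (n + 2) * r) = 0 := by
            intro r hr
            have e : orthoPoly L (n + 2) * r = orthoPoly L (n + 1) * (X * r)
                - C (orthoDiag L (n + 1)) * (orthoPoly L (n + 1) * r)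
                - C (orthoOff L (n + 1)) * (orthoPoly L n * r) := by
              rw [orthoPoly_succ L (n + 1), Nat.add_sub_cancel]; ring
            have hX : (X * r).natDegree ≤ n + 1 :=
              natDegree_mul_le.trans (by rw [natDegree_X]; omega)
            rw [e, map_sub, map_sub, map_C_mul, map_C_mul, hn _ hX, hn r (by omega), hn' r hr,
              coeff_X_mul, coeff_eq_zero_of_natDegree_lt (by omega : r.natDegree < n + 1),
              ← orthoOff_mul_orthoNorm hL n]
            ring
          have hdiag : L (orthoPoly L (n + 2) * orthoPoly L (n + 1)) = 0 := by
            have e : orthoPoly L (n + 2) * orthoPoly L (n + 1)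
                = X * (orthoPoly L (n + 1) * orthoPoly L (n + 1))
                - C (orthoDiag L (n + 1)) * (orthoPoly L (n + 1) * orthoPoly L (n + 1))
                - C (orthoOff L (n + 1)) * (orthoPoly L (n + 1) * orthoPoly L n) := by
              rw [orthoPoly_succ L (n + 1), Nat.add_sub_cancel]; ring
            have hd := natDegree_orthoPoly_le L n
            rw [e, map_sub, map_sub, map_C_mul, map_C_mul, orthoDiag_mul_orthoNorm hL,
              hn (orthoPoly L n) (by omega),
              coeff_eq_zero_of_natDegree_lt (by omega : (orthoPoly L n).natDegree < n + 1),
              orthoNorm]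
            ring
          intro r hr
          have e : orthoPoly L (n + 2) * r
              = orthoPoly L (n + 2) * (r - C (r.coeff (n + 1)) * orthoPoly L (n + 1))
              + C (r.coeff (n + 1)) * (orthoPoly L (n + 2) * orthoPoly L (n + 1)) := by ring
          rw [e, map_add, hlow _ (natDegree_sub_coeff_mul_orthoPoly_le L hr), map_C_mul, hdiag]
          ring
      intro q hq
      have e : orthoPoly L (n + 1) * q
          = orthoPoly L (n + 1) * (q - C (q.coeff (n + 1)) * orthoPoly L (n + 1))
          + C (q.coeff (n + 1)) * (orthoPoly L (n + 1) * orthoPoly L (n + 1)) := by ring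
      rw [e, map_add, key _ (natDegree_sub_coeff_mul_orthoPoly_le L hq), map_C_mul, orthoNorm]
      ring

theorem map_orthoPoly_mul_eq_zero (hL : PosDefFunctional L) {n : ℕ} {q : ℝ[X]}
    (hq : q.natDegree < n) : L (orthoPoly L n * q) = 0 := by
  rw [map_orthoPoly_mul hL n q hq.le, coeff_eq_zero_of_natDegree_lt hq, zero_mul]

theorem map_orthoPoly_mul_orthoPoly (hL : PosDefFunctional L) {m n : ℕ} (h : m ≠ n) :
    L (orthoPoly L m * orthoPoly L n) = 0 := by
  rcases lt_or_gt_of_ne h with h | h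
  · rw [mul_comm]
    exact map_orthoPoly_mul_eq_zero hL (by rwa [natDegree_orthoPoly])
  · exact map_orthoPoly_mul_eq_zero hL (by rwa [natDegree_orthoPoly])

theorem map_X_mul_orthoPoly_mul_succ (hL : PosDefFunctional L) (n : ℕ) :
    L (X * (orthoPoly L n * orthoPoly L (n + 1))) = orthoNorm L (n + 1) := by
  have hd := natDegree_orthoPoly_le L n
  rw [← mul_assoc, mul_comm, map_orthoPoly_mul hL (n + 1) _
    (natDegree_mul_le.trans (by rw [natDegree_X]; omega)), coeff_X_mul, coeff_orthoPoly_self,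
    one_mul]

theorem orthoOff_mul_map_X (hL : PosDefFunctional L) (n : ℕ) :
    orthoOff L n * L (orthoPoly L n * (X * orthoPoly L (n - 1)))
      = orthoOff L n * orthoNorm L n := by
  cases n with
  | zero => simp [orthoOff]
  | succ n =>
    rw [Nat.add_sub_cancel, ← map_X_mul_orthoPoly_mul_succ hL n]
    congr 2; ring

theorem orthoOff_mul_map_succ_X (hL : PosDefFunctional L) (n : ℕ) :
    orthoOff L n * L (orthoPoly L (n + 1) * (X * orthoPoly L (n - 1))) = 0 := by
  cases n with
  | zero => simp [orthoOff]
  | succ n =>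
    have hd := natDegree_orthoPoly_le L n
    rw [Nat.add_sub_cancel, map_orthoPoly_mul_eq_zero hL, mul_zero]
    exact lt_of_le_of_lt natDegree_mul_le (by rw [natDegree_X]; omega)

theorem map_X_sq_mul_orthoPoly_sq (hL : PosDefFunctional L) (n : ℕ) :
    L (X * (X * (orthoPoly L n * orthoPoly L n)))
      = (orthoDiag L n ^ 2 + orthoOff L n + orthoOff L (n + 1)) * orthoNorm L n := by
  have e : X * (X * (orthoPoly L n * orthoPoly L n))
      = X * (orthoPoly L n * orthoPoly L (n + 1))
      + C (orthoDiag L n) * (X * (orthoPoly L n * orthoPoly L n))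
      + C (orthoOff L n) * (orthoPoly L n * (X * orthoPoly L (n - 1))) := by
    linear_combination (X * orthoPoly L n) * X_mul_orthoPoly L n
  rw [e, map_add, map_add, map_C_mul, map_C_mul, orthoOff_mul_map_X hL,
    map_X_mul_orthoPoly_mul_succ hL, orthoDiag_mul_orthoNorm hL, ← orthoOff_mul_orthoNorm hL n]
  ring

theorem map_X_sq_mul_orthoPoly_mul_succ (hL : PosDefFunctional L) (n : ℕ) :
    L (X * (X * (orthoPoly L n * orthoPoly L (n + 1))))
      = (orthoDiag L n + orthoDiag L (n + 1)) * orthoNorm L (n + 1) := by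
  have e : X * (X * (orthoPoly L n * orthoPoly L (n + 1)))
      = X * (orthoPoly L (n + 1) * orthoPoly L (n + 1))
      + C (orthoDiag L n) * (X * (orthoPoly L n * orthoPoly L (n + 1)))
      + C (orthoOff L n) * (orthoPoly L (n + 1) * (X * orthoPoly L (n - 1))) := by
    linear_combination (X * orthoPoly L (n + 1)) * X_mul_orthoPoly L n
  rw [e, map_add, map_add, map_C_mul, map_C_mul, orthoOff_mul_map_succ_X hL,
    map_X_mul_orthoPoly_mul_succ hL, orthoDiag_mul_orthoNorm hL]
  ring

theorem coeff_X_mul_derivative (p : ℝ[X]) (k : ℕ) :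
    (X * derivative p).coeff k = k * p.coeff k := by
  cases k with
  | zero => simp
  | succ k => rw [coeff_X_mul, coeff_derivative]; push_cast; ring

theorem natDegree_X_mul_derivative_le (p : ℝ[X]) :
    (X * derivative p).natDegree ≤ p.natDegree := by
  rw [natDegree_le_iff_coeff_eq_zero]
  intro k hk
  rw [coeff_X_mul_derivative, coeff_eq_zero_of_natDegree_lt hk, mul_zero]

/-- Pearson equation of the weight `t ^ a * exp (-t ^ 2 + 2 * s * t)` on the half-line, in
terms of the associated functional. -/
def PearsonFunctional (a s : ℝ) (L : ℝ[X] →ₗ[ℝ] ℝ) : Prop :=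
  ∀ f : ℝ[X], L (X * derivative f) + (1 + a) * L f - 2 * L (X * (X * f)) + 2 * s * L (X * f) = 0

variable {a s : ℝ}

theorem PearsonFunctional.diag_eq (hL : PosDefFunctional L) (hP : PearsonFunctional a s L)
    (n : ℕ) :
    2 * n + 1 + a = 2 * (orthoDiag L n ^ 2 + orthoOff L n + orthoOff L (n + 1))
      - 2 * s * orthoDiag L n := by
  have h := hP (orthoPoly L n * orthoPoly L n)
  have e : X * derivative (orthoPoly L n * orthoPoly L n)
      = orthoPoly L n * (X * derivative (orthoPoly L n))
      + orthoPoly L n * (X * derivative (orthoPoly L n)) := by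
    rw [derivative_mul]; ring
  rw [e, map_add, map_orthoPoly_mul hL n _ ((natDegree_X_mul_derivative_le _).trans
    (natDegree_orthoPoly_le L n)), coeff_X_mul_derivative, coeff_orthoPoly_self,
    map_X_sq_mul_orthoPoly_sq hL, orthoDiag_mul_orthoNorm hL,
    show L (orthoPoly L n * orthoPoly L n) = orthoNorm L n from rfl] at h
  refine mul_right_cancel₀ (orthoNorm_pos hL n).ne' ?_
  linear_combination h

theorem PearsonFunctional.sum_diag_eq (hL : PosDefFunctional L) (hP : PearsonFunctional a s L)
    (n : ℕ) :
    ∑ j ∈ Finset.range (n + 1), orthoDiag L j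
      = 2 * orthoOff L (n + 1) * (orthoDiag L (n + 1) + orthoDiag L n - s) := by
  have h := hP (orthoPoly L n * orthoPoly L (n + 1))
  have e : X * derivative (orthoPoly L n * orthoPoly L (n + 1))
      = orthoPoly L (n + 1) * (X * derivative (orthoPoly L n))
      + (orthoPoly L n * (X * derivative (orthoPoly L (n + 1))
        - C ((n : ℝ) + 1) * orthoPoly L (n + 1))
      + C ((n : ℝ) + 1) * (orthoPoly L n * orthoPoly L (n + 1))) := by
    rw [derivative_mul]; ring
  have hd := natDegree_orthoPoly_le L n
  have hd1 := natDegree_orthoPoly_le L (n + 1)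
  have hlow : (X * derivative (orthoPoly L (n + 1))
      - C ((n : ℝ) + 1) * orthoPoly L (n + 1)).natDegree ≤ n := by
    rw [natDegree_le_iff_coeff_eq_zero]
    intro k hk
    rw [coeff_sub, coeff_C_mul, coeff_X_mul_derivative]
    rcases (Nat.succ_le_of_lt hk).eq_or_lt with h | h
    · rw [← h]; push_cast; ring
    · rw [coeff_eq_zero_of_natDegree_lt (by omega : (orthoPoly L (n + 1)).natDegree < k)]
      ring
  have h0 : L (orthoPoly L n * orthoPoly L (n + 1)) = 0 :=
    map_orthoPoly_mul_orthoPoly hL (by omega)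
  rw [e, map_add, map_add, map_C_mul, map_orthoPoly_mul hL n _ hlow,
    map_orthoPoly_mul_eq_zero hL (by have := natDegree_X_mul_derivative_le (orthoPoly L n); omega),
    coeff_sub, coeff_C_mul, coeff_X_mul_derivative, coeff_orthoPoly_succ, h0,
    map_X_sq_mul_orthoPoly_mul_succ hL, map_X_mul_orthoPoly_mul_succ hL,
    ← orthoOff_mul_orthoNorm hL n] at h
  refine mul_right_cancel₀ (orthoNorm_pos hL n).ne' ?_
  linear_combination h

/-- The first integral of the discrete system satisfied by the recurrence coefficients. -/
theorem PearsonFunctional.first_integral (hL : PosDefFunctional L)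
    (hP : PearsonFunctional a s L) (n : ℕ) :
    orthoOff L n * (2 * orthoDiag L n - 2 * s) * (2 * orthoDiag L (n - 1) - 2 * s)
      = (2 * orthoOff L n - n) * (2 * orthoOff L n - n - a) := by
  induction n with
  | zero => simp [orthoOff]
  | succ n ih =>
    have h3 := hP.diag_eq hL n
    have h2 : orthoDiag L n
        = 2 * orthoOff L (n + 1) * (orthoDiag L (n + 1) + orthoDiag L n - s)
        - 2 * orthoOff L n * (orthoDiag L n + orthoDiag L (n - 1) - s) := by
      have h1 := hP.sum_diag_eq hL n
      cases n with
      | zero => simpa [orthoOff] using h1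
      | succ n =>
        rw [Finset.sum_range_succ, hP.sum_diag_eq hL n] at h1
        rw [Nat.add_sub_cancel]
        linear_combination h1
    rw [Nat.add_sub_cancel]
    push_cast
    generalize orthoDiag L (n + 1) = x at *
    generalize orthoDiag L n = y at *
    generalize orthoDiag L (n - 1) = z at *
    generalize orthoOff L (n + 1) = p at *
    generalize orthoOff L n = q at *
    linear_combination ih - (2 * y - 2 * s) * h2 + (2 * p - 2 * q - 1) * h3

/-- `Q` is the coefficientwise derivative of the family of polynomials `P`, whose degrees are
bounded. -/
def HasCoeffDeriv (P Q : ℝ → ℝ[X]) : Prop :=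
  (∀ k s, HasDerivAt (fun s => (P s).coeff k) ((Q s).coeff k) s) ∧
    ∃ d, ∀ s, (P s).natDegree ≤ d

theorem HasCoeffDeriv.mul {P₁ P₂ Q₁ Q₂ : ℝ → ℝ[X]} (h₁ : HasCoeffDeriv P₁ Q₁)
    (h₂ : HasCoeffDeriv P₂ Q₂) :
    HasCoeffDeriv (fun s => P₁ s * P₂ s) (fun s => Q₁ s * P₂ s + P₁ s * Q₂ s) := by
  obtain ⟨h₁, d₁, hd₁⟩ := h₁
  obtain ⟨h₂, d₂, hd₂⟩ := h₂
  refine ⟨fun k s => ?_, d₁ + d₂, fun s => natDegree_mul_le_of_le (hd₁ s) (hd₂ s)⟩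
  simp only [coeff_add, coeff_mul, ← Finset.sum_add_distrib]
  exact HasDerivAt.fun_sum fun i _ => (h₁ i.1 s).mul (h₂ i.2 s)

theorem HasCoeffDeriv.sub {P₁ P₂ Q₁ Q₂ : ℝ → ℝ[X]} (h₁ : HasCoeffDeriv P₁ Q₁)
    (h₂ : HasCoeffDeriv P₂ Q₂) :
    HasCoeffDeriv (fun s => P₁ s - P₂ s) (fun s => Q₁ s - Q₂ s) := by
  obtain ⟨h₁, d₁, hd₁⟩ := h₁
  obtain ⟨h₂, d₂, hd₂⟩ := h₂
  refine ⟨fun k s => ?_, max d₁ d₂, fun s => natDegree_sub_le_of_le (hd₁ s) (hd₂ s)⟩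
  simp only [coeff_sub]
  exact (h₁ k s).sub (h₂ k s)

theorem hasCoeffDeriv_const (p : ℝ[X]) : HasCoeffDeriv (fun _ => p) (fun _ => 0) :=
  ⟨fun k s => by simpa using hasDerivAt_const s (p.coeff k), p.natDegree, fun _ => le_rfl⟩

theorem hasCoeffDeriv_C {f f' : ℝ → ℝ} (h : ∀ s, HasDerivAt f (f' s) s) :
    HasCoeffDeriv (fun s => C (f s)) (fun s => C (f' s)) := by
  refine ⟨fun k s => ?_, 0, fun s => (natDegree_C _).le⟩
  cases k with
  | zero => simpa using h s
  | succ k => simpa [coeff_C] using hasDerivAt_const s (0 : ℝ)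

theorem map_eq_sum_coeff_mul_moment (L : ℝ[X] →ₗ[ℝ] ℝ) {p : ℝ[X]} {d : ℕ}
    (hp : p.natDegree ≤ d) : L p = ∑ k ∈ Finset.range (d + 1), p.coeff k * L (X ^ k) := by
  conv_lhs => rw [p.as_sum_range_C_mul_X_pow' (Nat.lt_succ_of_le hp)]
  rw [map_sum]
  exact Finset.sum_congr rfl fun k _ => map_C_mul L _ _

/-- A family of functionals whose moments evolve by `mₖ' = 2 mₖ₊₁`. -/
def MomentFlow (L : ℝ → ℝ[X] →ₗ[ℝ] ℝ) : Prop :=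
  ∀ k s, HasDerivAt (fun s => L s (X ^ k)) (2 * L s (X ^ (k + 1))) s

variable {L : ℝ → ℝ[X] →ₗ[ℝ] ℝ}

theorem MomentFlow.hasDerivAt (hM : MomentFlow L) {P Q : ℝ → ℝ[X]} (h : HasCoeffDeriv P Q)
    (s : ℝ) : HasDerivAt (fun s => L s (P s)) (L s (Q s) + 2 * L s (X * P s)) s := by
  obtain ⟨h, d, hd⟩ := h
  have hQ : (Q s).natDegree ≤ d := by
    rw [natDegree_le_iff_coeff_eq_zero]
    intro k hk
    refine (h k s).unique ?_
    simp only [coeff_eq_zero_of_natDegree_lt (lt_of_le_of_lt (hd _) hk)]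
    exact hasDerivAt_const s 0
  have e : ∀ s, L s (P s) = ∑ k ∈ Finset.range (d + 1), (P s).coeff k * L s (X ^ k) :=
    fun s => map_eq_sum_coeff_mul_moment (L s) (hd s)
  have e' : L s (X * P s)
      = ∑ k ∈ Finset.range (d + 1), (P s).coeff k * L s (X ^ (k + 1)) := by
    have := map_eq_sum_coeff_mul_moment ((L s).comp (LinearMap.mulLeft ℝ X)) (hd s)
    simpa [← pow_succ'] using this
  simp only [e]
  rw [e', map_eq_sum_coeff_mul_moment (L s) hQ, Finset.mul_sum, ← Finset.sum_add_distrib]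
  refine HasDerivAt.fun_sum fun k _ => ?_
  refine ((h k s).mul (hM k s)).congr_deriv ?_
  ring

theorem MomentFlow.exists_hasDerivAt_orthoNorm (hM : MomentFlow L) {n : ℕ}
    (h : ∃ Q, HasCoeffDeriv (fun s => orthoPoly (L s) n) Q) :
    ∃ f : ℝ → ℝ, ∀ s, HasDerivAt (fun s => orthoNorm (L s) n) (f s) s := by
  obtain ⟨Q, hQ⟩ := h
  exact ⟨_, fun s => hM.hasDerivAt (hQ.mul hQ) s⟩

theorem MomentFlow.exists_hasDerivAt_orthoDiag (hM : MomentFlow L)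
    (hL : ∀ s, PosDefFunctional (L s)) {n : ℕ}
    (h : ∃ Q, HasCoeffDeriv (fun s => orthoPoly (L s) n) Q) :
    ∃ f : ℝ → ℝ, ∀ s, HasDerivAt (fun s => orthoDiag (L s) n) (f s) s := by
  obtain ⟨f, hf⟩ := hM.exists_hasDerivAt_orthoNorm h
  obtain ⟨Q, hQ⟩ := h
  exact ⟨_, fun s => (hM.hasDerivAt ((hasCoeffDeriv_const X).mul (hQ.mul hQ)) s).div (hf s)
    (orthoNorm_pos (hL s) n).ne'⟩

theorem MomentFlow.exists_hasCoeffDeriv_orthoPoly (hM : MomentFlow L)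
    (hL : ∀ s, PosDefFunctional (L s)) (n : ℕ) :
    ∃ Q, HasCoeffDeriv (fun s => orthoPoly (L s) n) Q := by
  induction n using Nat.strong_induction_on with
  | _ n ih =>
    cases n with
    | zero => exact ⟨_, by simpa only [orthoPoly] using hasCoeffDeriv_const 1⟩
    | succ n =>
      obtain ⟨f, hf⟩ := hM.exists_hasDerivAt_orthoDiag hL (ih n (by omega))
      have hg : ∃ g : ℝ → ℝ, ∀ s, HasDerivAt (fun s => orthoOff (L s) n) (g s) s := by
        cases n with
        | zero => exact ⟨fun _ => 0, fun s => by simpa only [orthoOff] using hasDerivAt_const s 0⟩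
        | succ n =>
          obtain ⟨f, hf⟩ := hM.exists_hasDerivAt_orthoNorm (ih (n + 1) (by omega))
          obtain ⟨g, hg⟩ := hM.exists_hasDerivAt_orthoNorm (ih n (by omega))
          exact ⟨_, fun s => (hf s).div (hg s) (orthoNorm_pos (hL s) n).ne'⟩
      obtain ⟨g, hg⟩ := hg
      obtain ⟨Q, hQ⟩ := ih n (by omega)
      obtain ⟨Q', hQ'⟩ := ih (n - 1) (by omega)
      simp only [orthoPoly_succ]
      exact ⟨_, (((hasCoeffDeriv_const X).sub (hasCoeffDeriv_C hf)).mul hQ).sub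
        ((hasCoeffDeriv_C hg).mul hQ')⟩

theorem natDegree_lt_of_hasCoeffDeriv_orthoPoly {n : ℕ} {Q : ℝ → ℝ[X]}
    (hQ : HasCoeffDeriv (fun s => orthoPoly (L s) (n + 1)) Q) (s : ℝ) :
    (Q s).natDegree ≤ n := by
  rw [natDegree_le_iff_coeff_eq_zero]
  intro k hk
  refine (hQ.1 k s).unique ?_
  rcases (Nat.succ_le_of_lt hk).eq_or_lt with h | h
  · simp only [← h, Nat.succ_eq_add_one, coeff_orthoPoly_self]
    exact hasDerivAt_const s 1
  · simp only [coeff_eq_zero_of_natDegree_lt (lt_of_le_of_lt (natDegree_orthoPoly_le _ (n + 1)) h)]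
    exact hasDerivAt_const s 0

theorem map_orthoPoly_mul_coeffDeriv (hL : ∀ s, PosDefFunctional (L s)) {n : ℕ} {Q : ℝ → ℝ[X]}
    (hQ : HasCoeffDeriv (fun s => orthoPoly (L s) n) Q) (s : ℝ) {m : ℕ} (hm : n ≤ m) :
    L s (orthoPoly (L s) m * Q s) = 0 := by
  cases n with
  | zero =>
    have : Q s = 0 := by
      ext k
      refine (hQ.1 k s).unique ?_
      simp only [orthoPoly]
      simpa using hasDerivAt_const s ((1 : ℝ[X]).coeff k)
    rw [this, mul_zero, map_zero]
  | succ n =>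
    exact map_orthoPoly_mul_eq_zero (hL s)
      (lt_of_le_of_lt (natDegree_lt_of_hasCoeffDeriv_orthoPoly hQ s) hm)

theorem MomentFlow.hasDerivAt_orthoNorm (hM : MomentFlow L)
    (hL : ∀ s, PosDefFunctional (L s)) (n : ℕ) (s : ℝ) :
    HasDerivAt (fun s => orthoNorm (L s) n) (2 * orthoDiag (L s) n * orthoNorm (L s) n) s := by
  obtain ⟨Q, hQ⟩ := hM.exists_hasCoeffDeriv_orthoPoly hL n
  refine (hM.hasDerivAt (hQ.mul hQ) s).congr_deriv ?_
  rw [map_add, mul_comm (Q s), map_orthoPoly_mul_coeffDeriv hL hQ s le_rfl,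
    orthoDiag_mul_orthoNorm (hL s)]
  ring

theorem MomentFlow.hasDerivAt_sum_orthoDiag (hM : MomentFlow L)
    (hL : ∀ s, PosDefFunctional (L s)) (n : ℕ) (s : ℝ) :
    HasDerivAt (fun s => ∑ j ∈ Finset.range (n + 1), orthoDiag (L s) j)
      (2 * orthoOff (L s) (n + 1)) s := by
  obtain ⟨Q, hQ⟩ := hM.exists_hasCoeffDeriv_orthoPoly hL n
  obtain ⟨R, hR⟩ := hM.exists_hasCoeffDeriv_orthoPoly hL (n + 1)
  have h0 : ∀ s, L s (orthoPoly (L s) n * orthoPoly (L s) (n + 1)) = 0 := fun s =>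
    map_orthoPoly_mul_orthoPoly (hL s) (by omega)
  have h1 := hM.hasDerivAt (hQ.mul hR) s
  simp only [h0] at h1
  have h2 := h1.unique (hasDerivAt_const s 0)
  rw [map_add, mul_comm (Q s), map_orthoPoly_mul_coeffDeriv hL hQ s (by omega),
    map_orthoPoly_mul (hL s) n _ (natDegree_lt_of_hasCoeffDeriv_orthoPoly hR s),
    map_X_mul_orthoPoly_mul_succ (hL s), ← orthoOff_mul_orthoNorm (hL s) n] at h2
  have h3 := (hR.1 n s).neg
  simp only [coeff_orthoPoly_succ, Pi.neg_def, neg_neg] at h3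
  refine h3.congr_deriv (mul_right_cancel₀ (orthoNorm_pos (hL s) n).ne' ?_)
  linear_combination -h2

theorem MomentFlow.hasDerivAt_orthoOff (hM : MomentFlow L)
    (hL : ∀ s, PosDefFunctional (L s)) (n : ℕ) (s : ℝ) :
    HasDerivAt (fun s => orthoOff (L s) (n + 1))
      (2 * orthoOff (L s) (n + 1) * (orthoDiag (L s) (n + 1) - orthoDiag (L s) n)) s := by
  have hn := (orthoNorm_pos (hL s) n).ne'
  refine ((hM.hasDerivAt_orthoNorm hL (n + 1) s).div (hM.hasDerivAt_orthoNorm hL n s)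
    hn).congr_deriv ?_
  rw [orthoOff]
  field_simp

/-- The σ-form of Painlevé IV for the logarithmic derivative of `∏ exp (-s²) hⱼ(s)`. -/
theorem MomentFlow.sigma_PIV (hM : MomentFlow L) (hL : ∀ s, PosDefFunctional (L s)) {a : ℝ}
    (hP : ∀ s, PearsonFunctional a s (L s)) (n : ℕ) {c : ℝ} (hc : 0 < c) {D U : ℝ → ℝ}
    (hD : ∀ s, D s = c * ∏ j ∈ Finset.range (n + 1), (Real.exp (-s ^ 2) * orthoNorm (L s) j))
    (hU : ∀ s, U s = deriv D s / D s) :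
    (∀ s, 0 < D s) ∧ Differentiable ℝ U ∧ Differentiable ℝ (deriv U) ∧
    ∀ s, (deriv (deriv U) s) ^ 2 - 4 * (s * deriv U s - U s) ^ 2
        + 4 * deriv U s * (deriv U s - 2 * a) * (deriv U s + 2 * (n + 1 : ℕ)) = 0 := by
  have hpos : ∀ s, 0 < D s := fun s => by
    rw [hD]
    exact mul_pos hc (Finset.prod_pos fun j _ => mul_pos (Real.exp_pos _) (orthoNorm_pos (hL s) j))
  have hterm : ∀ m s, HasDerivAt
      (fun s => ∏ j ∈ Finset.range m, (Real.exp (-s ^ 2) * orthoNorm (L s) j))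
      ((∏ j ∈ Finset.range m, (Real.exp (-s ^ 2) * orthoNorm (L s) j))
        * (-2 * m * s + 2 * ∑ j ∈ Finset.range m, orthoDiag (L s) j)) s := by
    intro m s
    induction m with
    | zero => simpa using hasDerivAt_const s (1 : ℝ)
    | succ m ih =>
      simp only [Finset.prod_range_succ, Finset.sum_range_succ]
      have he : HasDerivAt (fun s : ℝ => Real.exp (-s ^ 2)) (Real.exp (-s ^ 2) * (-(2 * s))) s := by
        simpa using ((hasDerivAt_id s).pow 2).neg.exp
      refine (ih.mul (he.fun_mul (hM.hasDerivAt_orthoNorm hL m s))).congr_deriv ?_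
      push_cast
      ring
  have hU' : U = fun s => -2 * (n + 1 : ℕ) * s
      + 2 * ∑ j ∈ Finset.range (n + 1), orthoDiag (L s) j := by
    funext s
    have hDs : HasDerivAt D (D s * (-2 * (n + 1 : ℕ) * s
        + 2 * ∑ j ∈ Finset.range (n + 1), orthoDiag (L s) j)) s := by
      rw [hD s, funext hD]
      exact ((hterm (n + 1) s).const_mul c).congr_deriv (by ring)
    rw [hU, hDs.deriv, mul_div_cancel_left₀ _ (hpos s).ne']
  have hU1 : ∀ s, HasDerivAt U (-2 * (n + 1 : ℕ) + 4 * orthoOff (L s) (n + 1)) s := fun s => by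
    rw [hU']
    refine (((hasDerivAt_id s).const_mul _).add
      ((hM.hasDerivAt_sum_orthoDiag hL n s).const_mul 2)).congr_deriv ?_
    ring
  have hdU : deriv U = fun s => -2 * (n + 1 : ℕ) + 4 * orthoOff (L s) (n + 1) :=
    funext fun s => (hU1 s).deriv
  have hU2 : ∀ s, HasDerivAt (deriv U) (8 * orthoOff (L s) (n + 1)
      * (orthoDiag (L s) (n + 1) - orthoDiag (L s) n)) s := fun s => by
    rw [hdU]
    refine (((hM.hasDerivAt_orthoOff hL n s).const_mul 4).const_add _).congr_deriv ?_
    ring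
  refine ⟨hpos, fun s => (hU1 s).differentiableAt, fun s => (hU2 s).differentiableAt, fun s => ?_⟩
  have h1 := (hP s).sum_diag_eq (hL s) n
  have h2 := (hP s).first_integral (hL s) (n + 1)
  rw [(hU2 s).deriv, (hU1 s).deriv, hU']
  simp only [h1, Nat.add_sub_cancel] at h2 ⊢
  linear_combination (-64 * orthoOff (L s) (n + 1)) * h2

end OrthogonalPolynomials

section Heine

/-- Andréief's identity for an orthogonal system. -/
theorem integral_prod_mul_det_sq {N : ℕ} (ν : Measure ℝ) [SigmaFinite ν] (ω : ℝ → ℝ)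
    (φ : Fin N → ℝ → ℝ) (h : Fin N → ℝ)
    (hint : ∀ i j, Integrable (fun x => ω x * (φ i x * φ j x)) ν)
    (horth : ∀ i j, ∫ x, ω x * (φ i x * φ j x) ∂ν = if i = j then h i else 0) :
    ∫ x, (∏ j, ω (x j)) * (Matrix.of fun i j => φ i (x j)).det ^ 2 ∂(Measure.pi fun _ => ν)
      = N.factorial * ∏ i, h i := by
  have expand : ∀ x : Fin N → ℝ, (∏ j, ω (x j)) * (Matrix.of fun i j => φ i (x j)).det ^ 2
      = ∑ σ : Equiv.Perm (Fin N), ∑ τ : Equiv.Perm (Fin N),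
        ((Equiv.Perm.sign σ : ℤ) : ℝ) * ((Equiv.Perm.sign τ : ℤ) : ℝ)
          * ∏ i, ω (x i) * (φ (σ i) (x i) * φ (τ i) (x i)) := by
    intro x
    rw [sq, Matrix.det_apply', Finset.sum_mul_sum, Finset.mul_sum]
    refine Finset.sum_congr rfl fun σ _ => ?_
    rw [Finset.mul_sum]
    refine Finset.sum_congr rfl fun τ _ => ?_
    simp only [Matrix.of_apply, Finset.prod_mul_distrib]
    ring
  have hprod : ∀ σ τ : Equiv.Perm (Fin N), Integrable (fun x : Fin N → ℝ =>
      ((Equiv.Perm.sign σ : ℤ) : ℝ) * ((Equiv.Perm.sign τ : ℤ) : ℝ)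
        * ∏ i, ω (x i) * (φ (σ i) (x i) * φ (τ i) (x i))) (Measure.pi fun _ => ν) :=
    fun σ τ => (Integrable.fintype_prod (f := fun i x => ω x * (φ (σ i) x * φ (τ i) x))
      fun i => hint (σ i) (τ i)).const_mul _
  have hval : ∀ σ τ : Equiv.Perm (Fin N), ∫ x : Fin N → ℝ,
      ((Equiv.Perm.sign σ : ℤ) : ℝ) * ((Equiv.Perm.sign τ : ℤ) : ℝ)
        * ∏ i, ω (x i) * (φ (σ i) (x i) * φ (τ i) (x i)) ∂(Measure.pi fun _ => ν)
      = if σ = τ then ∏ i, h i else 0 := by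
    intro σ τ
    rw [integral_const_mul,
      integral_fintype_prod_eq_prod (fun i x => ω x * (φ (σ i) x * φ (τ i) x))]
    simp only [horth]
    split_ifs with hστ
    · subst hστ
      simp only [if_true]
      rw [Equiv.prod_comp σ h]
      rcases Int.units_eq_one_or (Equiv.Perm.sign σ) with hs | hs <;> simp [hs]
    · obtain ⟨i, hi⟩ : ∃ i, σ i ≠ τ i := by
        by_contra! hcon
        exact hστ (Equiv.ext hcon)
      rw [Finset.prod_eq_zero (Finset.mem_univ i) (if_neg hi), mul_zero]
  simp only [expand]
  rw [integral_finsetSum _ fun σ _ => integrable_finsetSum _ fun τ _ => hprod σ τ]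
  simp only [integral_finsetSum _ fun τ _ => hprod _ τ, hval, Finset.sum_ite_eq,
    Finset.mem_univ, if_true, Finset.sum_const, Finset.card_univ, Fintype.card_perm,
    Fintype.card_fin, nsmul_eq_mul]

end Heine

section GaussianHalfLine

open Polynomial Set Filter Topology

/-- The semi-classical Laguerre weight. -/
noncomputable def laguerreWeight (a s t : ℝ) : ℝ := t ^ a * Real.exp (-t ^ 2 + 2 * s * t)

theorem measurable_laguerreWeight (a s : ℝ) : Measurable (laguerreWeight a s) := by
  unfold laguerreWeight; fun_prop

theorem laguerreWeight_pos (a s : ℝ) {t : ℝ} (ht : 0 < t) : 0 < laguerreWeight a s t :=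
  mul_pos (Real.rpow_pos_of_pos ht a) (Real.exp_pos _)

theorem integrableOn_pow_mul_laguerreWeight {a : ℝ} (ha : 0 ≤ a) (s : ℝ) (k : ℕ) :
    IntegrableOn (fun t => t ^ k * laguerreWeight a s t) (Ioi 0) := by
  have hk : (-1 : ℝ) < k + a := by have : (0 : ℝ) ≤ k := k.cast_nonneg; linarith
  refine Integrable.mono' ((integrableOn_rpow_mul_exp_neg_mul_sq (b := 1 / 2) (by norm_num)
    hk).const_mul (Real.exp (2 * s ^ 2)))
    (((measurable_id.pow_const k).mul (measurable_laguerreWeight a s)).aestronglyMeasurable) ?_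
  filter_upwards [ae_restrict_mem measurableSet_Ioi] with t ht
  have ht : 0 < t := ht
  rw [Real.norm_of_nonneg (mul_pos (pow_pos ht k) (laguerreWeight_pos a s ht)).le,
    laguerreWeight, Real.rpow_add ht, Real.rpow_natCast]
  have he : Real.exp (-t ^ 2 + 2 * s * t)
      ≤ Real.exp (2 * s ^ 2) * Real.exp (-(1 / 2) * t ^ 2) := by
    rw [← Real.exp_add, Real.exp_le_exp]
    nlinarith [sq_nonneg (t - 2 * s)]
  calc t ^ k * (t ^ a * Real.exp (-t ^ 2 + 2 * s * t))
      ≤ t ^ k * (t ^ a * (Real.exp (2 * s ^ 2) * Real.exp (-(1 / 2) * t ^ 2))) := by gcongr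
    _ = _ := by ring

theorem integrableOn_eval_mul_laguerreWeight {a : ℝ} (ha : 0 ≤ a) (s : ℝ) (p : ℝ[X]) :
    IntegrableOn (fun t => p.eval t * laguerreWeight a s t) (Ioi 0) := by
  simp only [eval_eq_sum_range, Finset.sum_mul, mul_assoc]
  exact integrable_finsetSum _ fun k _ => (integrableOn_pow_mul_laguerreWeight ha s k).const_mul _

/-- Integration of polynomials against the semi-classical Laguerre weight. -/
noncomputable def laguerreFunctional {a : ℝ} (ha : 0 ≤ a) (s : ℝ) : ℝ[X] →ₗ[ℝ] ℝ where
  toFun p := ∫ t in Ioi 0, p.eval t * laguerreWeight a s t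
  map_add' p q := by
    simp only [eval_add, add_mul]
    exact integral_add (integrableOn_eval_mul_laguerreWeight ha s p)
      (integrableOn_eval_mul_laguerreWeight ha s q)
  map_smul' c p := by
    simp only [eval_smul, smul_eq_mul, mul_assoc, RingHom.id_apply, integral_const_mul]

variable {a : ℝ} (ha : 0 ≤ a)

theorem laguerreFunctional_apply (s : ℝ) (p : ℝ[X]) :
    laguerreFunctional ha s p = ∫ t in Ioi 0, p.eval t * laguerreWeight a s t := rfl

theorem posDef_laguerreFunctional (s : ℝ) : PosDefFunctional (laguerreFunctional ha s) := by
  intro p hp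
  rw [laguerreFunctional_apply, setIntegral_pos_iff_support_of_nonneg_ae ?_
    (integrableOn_eval_mul_laguerreWeight ha s (p * p))]
  · have hsub : Ioi (0 : ℝ) \ (p.roots.toFinset : Set ℝ) ⊆
        Function.support (fun t => (p * p).eval t * laguerreWeight a s t) ∩ Ioi 0 := by
      rintro t ⟨ht, hr⟩
      have hroot : p.eval t ≠ 0 := by simpa [hp] using hr
      refine ⟨?_, ht⟩
      rw [Function.mem_support, eval_mul]
      exact mul_ne_zero (mul_ne_zero hroot hroot) (laguerreWeight_pos a s ht).ne'
    refine lt_of_lt_of_le ?_ (measure_mono hsub)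
    rw [measure_sdiff_null (Finset.measure_zero _ _), Real.volume_Ioi]
    exact ENNReal.zero_lt_top
  · filter_upwards [ae_restrict_mem measurableSet_Ioi] with t ht
    rw [eval_mul]
    exact mul_nonneg (mul_self_nonneg _) (laguerreWeight_pos a s ht).le

theorem momentFlow_laguerreFunctional : MomentFlow (laguerreFunctional ha) := by
  intro k s
  simp only [laguerreFunctional_apply, eval_pow, eval_X]
  rw [← integral_const_mul]
  refine (hasDerivAt_integral_of_dominated_loc_of_deriv_le
    (F := fun s t => t ^ k * laguerreWeight a s t)
    (F' := fun s t => 2 * (t ^ (k + 1) * laguerreWeight a s t))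
    (bound := fun t => 2 * (t ^ (k + 1) * laguerreWeight a (s + 1) t))
    (Iio_mem_nhds (lt_add_one s)) ?_ (integrableOn_pow_mul_laguerreWeight ha s k) ?_ ?_
    ((integrableOn_pow_mul_laguerreWeight ha (s + 1) (k + 1)).const_mul 2) ?_).2
  · exact Eventually.of_forall fun s =>
      ((measurable_id.pow_const k).mul (measurable_laguerreWeight a s)).aestronglyMeasurable
  · exact (((measurable_id.pow_const (k + 1)).mul
      (measurable_laguerreWeight a s)).const_mul 2).aestronglyMeasurable
  · filter_upwards [ae_restrict_mem measurableSet_Ioi] with t ht r hr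
    have ht : 0 < t := ht
    have hr : r < s + 1 := hr
    rw [Real.norm_of_nonneg (mul_pos two_pos
      (mul_pos (pow_pos ht (k + 1)) (laguerreWeight_pos a r ht))).le]
    unfold laguerreWeight
    gcongr
  · filter_upwards with t r _
    have h1 : HasDerivAt (fun r : ℝ => -t ^ 2 + 2 * r * t) (2 * t) r := by
      simpa using (((hasDerivAt_id r).const_mul 2).mul_const t).const_add (-t ^ 2)
    refine ((h1.exp.const_mul (t ^ a)).const_mul (t ^ k)).congr_deriv ?_
    rw [laguerreWeight]; ring

theorem pearson_laguerreFunctional (s : ℝ) :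
    PearsonFunctional a s (laguerreFunctional ha s) := by
  intro f
  set q : ℝ[X] := X * derivative f + C (1 + a) * f - C 2 * (X * (X * f)) + C (2 * s) * (X * f)
    with hq
  have hLq : laguerreFunctional ha s q = laguerreFunctional ha s (X * derivative f)
      + (1 + a) * laguerreFunctional ha s f - 2 * laguerreFunctional ha s (X * (X * f))
      + 2 * s * laguerreFunctional ha s (X * f) := by
    rw [hq, map_add, map_sub, map_add, map_C_mul, map_C_mul, map_C_mul]
  rw [← hLq, laguerreFunctional_apply]
  set G : ℝ → ℝ := fun t => f.eval t * (t ^ (1 + a) * Real.exp (-t ^ 2 + 2 * s * t)) with hG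
  have hderiv : ∀ t ∈ Ioi (0 : ℝ), HasDerivAt G (q.eval t * laguerreWeight a s t) t := by
    intro t ht
    have ht : 0 < t := ht
    have h1 : HasDerivAt (fun t : ℝ => -t ^ 2 + 2 * s * t) (-(2 * t) + 2 * s) t := by
      simpa using ((hasDerivAt_pow 2 t).fun_neg).fun_add ((hasDerivAt_id' t).const_mul (2 * s))
    have h2 : HasDerivAt (fun t : ℝ => t ^ (1 + a)) ((1 + a) * t ^ a) t := by
      simpa using Real.hasDerivAt_rpow_const (x := t) (p := 1 + a) (Or.inl ht.ne')
    refine ((f.hasDerivAt t).mul (h2.fun_mul h1.exp)).congr_deriv ?_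
    simp only [hq, eval_add, eval_sub, eval_mul, eval_X, eval_C, laguerreWeight,
      Real.rpow_add ht, Real.rpow_one]
    ring
  have hGint : IntegrableOn G (Ioi 0) := by
    refine (integrableOn_eval_mul_laguerreWeight ha s (X * f)).congr_fun (fun t ht => ?_)
      measurableSet_Ioi
    have ht : 0 < t := ht
    simp only [hG, laguerreWeight, eval_mul, eval_X, Real.rpow_add ht, Real.rpow_one]
    ring
  have hint := integrableOn_eval_mul_laguerreWeight ha s q
  have hcont : Continuous G := by
    have : Continuous fun t : ℝ => t ^ (1 + a) := Real.continuous_rpow_const (by linarith)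
    fun_prop
  rw [integral_Ioi_of_hasDerivAt_of_tendsto hcont.continuousWithinAt hderiv hint
    (tendsto_zero_of_hasDerivAt_of_integrableOn_Ioi hderiv hint hGint)]
  simp [hG, Real.zero_rpow (by linarith : 1 + a ≠ 0)]

theorem exp_mul_rpow_eq_laguerreWeight (s x : ℝ) :
    Real.exp (-x ^ 2) * (s - x) ^ a = Real.exp (-s ^ 2) * laguerreWeight a s (s - x) := by
  have : Real.exp (-x ^ 2) = Real.exp (-s ^ 2) * Real.exp (-(s - x) ^ 2 + 2 * s * (s - x)) := by
    rw [← Real.exp_add]; congr 1; ring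
  rw [this, laguerreWeight]; ring

theorem integrableOn_Iic_eval_sub {a : ℝ} (ha : 0 ≤ a) (s : ℝ) (p : ℝ[X]) :
    IntegrableOn (fun x => Real.exp (-x ^ 2) * (s - x) ^ a * p.eval (s - x)) (Iic s) := by
  have h := ((integrableOn_Ici_iff_integrableOn_Ioi).mpr
    (integrableOn_eval_mul_laguerreWeight ha s p)).const_mul (Real.exp (-s ^ 2))
  have := (Measure.measurePreserving_sub_left (volume : Measure ℝ) s).integrableOn_comp_preimage
    (Homeomorph.subLeft s).measurableEmbedding (f := fun t =>
      Real.exp (-s ^ 2) * (p.eval t * laguerreWeight a s t)) (s := Ici 0)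
  have h' := this.mpr h
  have hpre : (fun x => s - x) ⁻¹' Ici (0 : ℝ) = Iic s := by ext x; simp
  rw [hpre] at h'
  refine h'.congr_fun (fun x _ => ?_) measurableSet_Iic
  rw [exp_mul_rpow_eq_laguerreWeight]
  simp only [Function.comp_apply]
  ring

theorem integral_Iic_eval_sub (s : ℝ) (p : ℝ[X]) :
    ∫ x in Iic s, Real.exp (-x ^ 2) * (s - x) ^ a * p.eval (s - x)
      = Real.exp (-s ^ 2) * laguerreFunctional ha s p := by
  have := (Measure.measurePreserving_sub_left (volume : Measure ℝ) s).setIntegral_preimage_emb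
    (Homeomorph.subLeft s).measurableEmbedding (fun t =>
      Real.exp (-s ^ 2) * (p.eval t * laguerreWeight a s t)) (Ici 0)
  have hpre : (fun x => s - x) ⁻¹' Ici (0 : ℝ) = Iic s := by ext x; simp
  rw [hpre, integral_Ici_eq_integral_Ioi] at this
  rw [laguerreFunctional_apply, ← integral_const_mul, ← this]
  refine setIntegral_congr_fun measurableSet_Iic fun x _ => ?_
  simp only [exp_mul_rpow_eq_laguerreWeight]
  ring

theorem gue_integral_eq_prod_orthoNorm (N : ℕ) (s : ℝ) :
    ∫ x in univ.pi fun _ : Fin N => Iic s,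
        (∏ j, Real.exp (-(x j) ^ 2) * (s - x j) ^ a)
          * ∏ j, ∏ k ∈ Finset.Ioi j, (x k - x j) ^ 2
      = N.factorial * ∏ j ∈ Finset.range N,
        (Real.exp (-s ^ 2) * orthoNorm (laguerreFunctional ha s) j) := by
  set L := laguerreFunctional ha s with hLdef
  have hdet : ∀ x : Fin N → ℝ, ∏ j, ∏ k ∈ Finset.Ioi j, (x k - x j) ^ 2
      = (Matrix.of fun i j : Fin N => (orthoPoly L i).eval (s - x j)).det ^ 2 := by
    intro x
    have h1 := Matrix.det_eval_matrixOfPolynomials_eq_det_vandermonde (fun i => s - x i)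
      (fun i : Fin N => orthoPoly L i) (fun i => natDegree_orthoPoly L i)
      (fun i => monic_orthoPoly L i)
    rw [← Matrix.det_transpose] at h1
    rw [← Matrix.det_transpose, show (Matrix.of fun i j : Fin N =>
      (orthoPoly L i).eval (s - x j)).transpose = Matrix.of fun i j : Fin N =>
      (orthoPoly L j).eval (s - x i) from rfl, ← h1, Matrix.det_transpose,
      Matrix.det_vandermonde, ← Finset.prod_pow]
    refine Finset.prod_congr rfl fun j _ => ?_
    rw [← Finset.prod_pow]
    exact Finset.prod_congr rfl fun k _ => by ring
  simp only [hdet]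
  rw [volume_pi, Measure.restrict_pi_pi, integral_prod_mul_det_sq (volume.restrict (Iic s))
    (fun x => Real.exp (-x ^ 2) * (s - x) ^ a) (fun i x => (orthoPoly L i).eval (s - x))
    (fun i => Real.exp (-s ^ 2) * orthoNorm L i),
    Fin.prod_univ_eq_prod_range (fun i => Real.exp (-s ^ 2) * orthoNorm L i)]
  · intro i j
    simp only [← eval_mul]
    exact integrableOn_Iic_eval_sub ha s _
  · intro i j
    simp only [← eval_mul]
    rw [integral_Iic_eval_sub ha]
    split_ifs with h
    · rw [h, orthoNorm]
    · rw [map_orthoPoly_mul_orthoPoly (posDef_laguerreFunctional ha s)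
        (fun h' => h (Fin.ext h')), mul_zero]

end GaussianHalfLine

/-- The logarithmic derivative `U_N(s;a)` of
`D_N(s;a) = ∫_{(-∞,s]^N} ∏ e^{-x_j²}(s-x_j)^a ∏_{j<k}(x_k-x_j)² dx` satisfies the
Jimbo–Miwa–Okamoto σ-form of PIV:
`(U'')² - 4(sU' - U)² + 4U'(U' - 2a)(U' + 2N) = 0`. -/
theorem tildeE_sigma_PIV (N : ℕ) (hN : 0 < N) (a : ℝ) (ha : 0 ≤ a) (D U : ℝ → ℝ)
    (hD : ∀ s, D s = ∫ x in Set.univ.pi fun _ : Fin N => Set.Iic s,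
        (∏ j, Real.exp (-(x j) ^ 2) * (s - x j) ^ a)
          * ∏ j, ∏ k ∈ Finset.Ioi j, (x k - x j) ^ 2)
    (hU : ∀ s, U s = deriv D s / D s) :
    (∀ s, 0 < D s) ∧ Differentiable ℝ U ∧ Differentiable ℝ (deriv U) ∧
    ∀ s, (deriv (deriv U) s) ^ 2 - 4 * (s * deriv U s - U s) ^ 2
        + 4 * deriv U s * (deriv U s - 2 * a) * (deriv U s + 2 * N) = 0 := by
  obtain ⟨n, rfl⟩ : ∃ n, N = n + 1 := ⟨N - 1, by omega⟩
  exact (momentFlow_laguerreFunctional ha).sigma_PIV (posDef_laguerreFunctional ha)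
    (pearson_laguerreFunctional ha) n (Nat.cast_pos.mpr (n + 1).factorial_pos)
    (fun s => (hD s).trans (gue_integral_eq_prod_orthoNorm ha (n + 1) s)) hU
end
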